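/- Let k be an infinite cardinal and let X be an absolute G_δσ-set such that Ind X = 0, X is nowhere 𝓕_σδ ∖ σLW(<k), X contains a dense topologically complete subspace, and the weight of X equals k. Then X is homeomorphic to A^{II}_k, i.e., to the complement B*(k) ∖ A of a dense subset A of B*(k) homeomorphic to Q(k)^ω. -/

import Mathlib

open Topology Set Filter

universe u v

noncomputable section

/-- Strong zero-dimensionality (`Ind X = 0`): any two disjoint closed sets
can be separated by a clopen set. -/
def StronglyZeroDim (X : Type*) [TopologicalSpace X] : Prop :=
  ∀ A B : Set X, IsClosed A → IsClosed B → Disjoint A B →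
    ∃ U : Set X, IsClopen U ∧ A ⊆ U ∧ Disjoint B U

/-- The topological weight of a space: the least cardinality of a base. -/
def topWeight (X : Type u) [TopologicalSpace X] : Cardinal.{u} :=
  ⨅ B : {B : Set (Set X) // TopologicalSpace.IsTopologicalBasis B}, Cardinal.mk B.1

/-- The space has a base of cardinality `< k`. -/
def WeightLT (X : Type u) [TopologicalSpace X] (k : Cardinal.{u}) : Prop :=
  ∃ B : Set (Set X), TopologicalSpace.IsTopologicalBasis B ∧ Cardinal.mk B < k

/-- Every point has a neighborhood of weight `< k`. -/
def LocallyWeightLT (X : Type u) [TopologicalSpace X] (k : Cardinal.{u}) : Prop :=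
  ∀ x : X, ∃ s : Set X, s ∈ nhds x ∧ WeightLT ↥s k

/-- `X ∈ σLW(<k)`: `X` is a countable union of subspaces, each locally of weight `< k`. -/
def SigmaLW (X : Type u) [TopologicalSpace X] (k : Cardinal.{u}) : Prop :=
  ∃ S : ℕ → Set X, (⋃ n, S n) = Set.univ ∧ ∀ n, LocallyWeightLT ↥(S n) k

/-- A `G_δσ`-subset: a countable union of `G_δ`-sets. -/
def IsGdeltaSigma {Y : Type*} [TopologicalSpace Y] (s : Set Y) : Prop :=
  ∃ G : ℕ → Set Y, (∀ n, IsGδ (G n)) ∧ s = ⋃ n, G n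

/-- An `F_σ`-subset: a countable union of closed sets. -/
def IsFsigmaSet {Y : Type*} [TopologicalSpace Y] (s : Set Y) : Prop :=
  ∃ F : ℕ → Set Y, (∀ n, IsClosed (F n)) ∧ s = ⋃ n, F n

/-- An `F_σδ`-subset: a countable intersection of `F_σ`-sets. -/
def IsFsigmaDelta {Y : Type*} [TopologicalSpace Y] (s : Set Y) : Prop :=
  ∃ F : ℕ → Set Y, (∀ n, IsFsigmaSet (F n)) ∧ s = ⋂ n, F n

/-- An absolute `G_δσ`-set: a metrizable space whose image under every embedding
into a metrizable space is a countable union of `G_δ`-sets. -/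
def AbsGdeltaSigma (X : Type u) [TopologicalSpace X] : Prop :=
  TopologicalSpace.MetrizableSpace X ∧
    ∀ (Y : Type u) [TopologicalSpace Y] [TopologicalSpace.MetrizableSpace Y]
      (f : X → Y), Topology.IsEmbedding f → IsGdeltaSigma (Set.range f)

/-- An absolute `F_σδ`-set: a metrizable space whose image under every embedding
into a metrizable space is an `F_σδ`-set. -/
def AbsFsigmaDelta (X : Type u) [TopologicalSpace X] : Prop :=
  TopologicalSpace.MetrizableSpace X ∧
    ∀ (Y : Type u) [TopologicalSpace Y] [TopologicalSpace.MetrizableSpace Y]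
      (f : X → Y), Topology.IsEmbedding f → IsFsigmaDelta (Set.range f)

/-- `X ∈ σLW(<k) + 𝒢_δσ` : `X = A ∪ B` with `A ∈ σLW(<k)` and `B` an absolute
`G_δσ`-set. -/
def SLWplusGDS (X : Type u) [TopologicalSpace X] (k : Cardinal.{u}) : Prop :=
  ∃ A B : Set X, A ∪ B = Set.univ ∧ SigmaLW ↥A k ∧ AbsGdeltaSigma ↥B

/-- No nonempty open subspace is `σLW(<k) + 𝒢_δσ`. -/
def NowhereSLWplusGDS (X : Type u) [TopologicalSpace X] (k : Cardinal.{u}) : Prop :=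
  ∀ U : Set X, IsOpen U → U.Nonempty → ¬ SLWplusGDS ↥U k

/-- A space is of first category if it is meager in itself. -/
def FirstCategory (X : Type*) [TopologicalSpace X] : Prop :=
  IsMeagre (Set.univ : Set X)

/-- A Souslin (analytic) subset of a space:
`s = ⋃_{t ∈ ω^ω} ⋂_n F(t↾n)` for a family of closed sets indexed by finite tuples. -/
def IsSuslinIn {Y : Type*} [TopologicalSpace Y] (s : Set Y) : Prop :=
  ∃ F : List ℕ → Set Y, (∀ l, IsClosed (F l)) ∧
    s = ⋃ t : ℕ → ℕ, ⋂ n : ℕ, F (List.ofFn fun i : Fin n => t i)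

/-- An absolute Souslin space: metrizable, and Souslin in every completely metrizable
space into which it embeds. -/
def AbsSuslin (X : Type u) [TopologicalSpace X] : Prop :=
  TopologicalSpace.MetrizableSpace X ∧
    ∀ (Y : Type u) [MetricSpace Y] [CompleteSpace Y] (f : X → Y),
      Topology.IsEmbedding f → IsSuslinIn (Set.range f)

/-- An h-homogeneous space: every nonempty clopen subset is homeomorphic to the
whole space. -/
def HHomogeneous (X : Type*) [TopologicalSpace X] : Prop :=
  ∀ U : Set X, IsClopen U → U.Nonempty → Nonempty (↥U ≃ₜ X)

/-- A discrete family of sets: every point has a neighborhood meeting at most one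
member of the family. -/
def DiscreteFamily {X : Type*} [TopologicalSpace X] {ι : Type*} (f : ι → Set X) : Prop :=
  ∀ x : X, ∃ U ∈ nhds x, {i | (f i ∩ U).Nonempty}.Subsingleton

/-- A discrete space of cardinality `k`. -/
def DiscT (k : Cardinal.{u}) : Type u := k.out

instance (k : Cardinal.{u}) : TopologicalSpace (DiscT k) := ⊥
instance (k : Cardinal.{u}) : DiscreteTopology (DiscT k) := ⟨rfl⟩

/-- The Baire space `B(k) = k^ω`. -/
def BaireB (k : Cardinal.{u}) : Type u := ℕ → DiscT k

instance (k : Cardinal.{u}) : TopologicalSpace (BaireB k) :=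
  inferInstanceAs (TopologicalSpace (ℕ → DiscT k))

open Classical in
/-- The discrete factor of `B*(k)`: two points if `k = ℵ₀`, and `k` points otherwise. -/
def StarT (k : Cardinal.{u}) : Type u :=
  if k = Cardinal.aleph0 then ULift Bool else DiscT k

instance (k : Cardinal.{u}) : TopologicalSpace (StarT k) := ⊥
instance (k : Cardinal.{u}) : DiscreteTopology (StarT k) := ⟨rfl⟩

/-- `B*(k)`: the Cantor set `2^ω` if `k = ℵ₀`, and the Baire space `B(k)` if `k > ℵ₀`. -/
def BaireStar (k : Cardinal.{u}) : Type u := ℕ → StarT k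

instance (k : Cardinal.{u}) : TopologicalSpace (BaireStar k) :=
  inferInstanceAs (TopologicalSpace (ℕ → StarT k))

/-- A discrete space of cardinality `k` (for infinite `k`), with a distinguished basepoint. -/
def QBase (k : Cardinal.{u}) : Type u := DiscT k ⊕ PUnit.{u + 1}

instance (k : Cardinal.{u}) : TopologicalSpace (QBase k) := ⊥
instance (k : Cardinal.{u}) : DiscreteTopology (QBase k) := ⟨rfl⟩

/-- `Q(k)`: the σ-product of `ω` copies of a discrete space of cardinality `k`, i.e.
the subspace of the product consisting of the sequences eventually equal to the basepoint. -/
def Qk (k : Cardinal.{u}) : Type u :=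
  {x : ℕ → QBase k // ∀ᶠ n in Filter.atTop, x n = Sum.inr PUnit.unit}

instance (k : Cardinal.{u}) : TopologicalSpace (Qk k) :=
  inferInstanceAs (TopologicalSpace
    {x : ℕ → QBase k // ∀ᶠ n in Filter.atTop, x n = Sum.inr PUnit.unit})

/-- The countable power `Q(k)^ω`. -/
def QkOmega (k : Cardinal.{u}) : Type u := ℕ → Qk k

instance (k : Cardinal.{u}) : TopologicalSpace (QkOmega k) :=
  inferInstanceAs (TopologicalSpace (ℕ → Qk k))

/-- `Z` is homeomorphic to `Q(k)^ω`. -/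
def IsQkOmega (k : Cardinal.{u}) (Z : Type*) [TopologicalSpace Z] : Prop :=
  Nonempty (Z ≃ₜ QkOmega k)

/-- `Z` is homeomorphic to `A^{II}_k`, the complement in `B*(k)` of a dense copy of
`Q(k)^ω`. -/
def IsAII (k : Cardinal.{u}) (Z : Type*) [TopologicalSpace Z] : Prop :=
  ∃ A : Set (BaireStar k), Dense A ∧ IsQkOmega k ↥A ∧ Nonempty (Z ≃ₜ ↥(Aᶜ))

/-- `Z` is homeomorphic to `A^I_k = Q × A^{II}_k`. -/
def IsAI (k : Cardinal.{u}) (Z : Type*) [TopologicalSpace Z] : Prop :=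
  ∃ A : Set (BaireStar k), Dense A ∧ IsQkOmega k ↥A ∧ Nonempty (Z ≃ₜ (ℚ × ↥(Aᶜ)))

/-- `Z` is homeomorphic to `M^{II}_k`, the complement in `B*(k)` of a dense copy of
`A^I_k`. -/
def IsMII (k : Cardinal.{u}) (Z : Type*) [TopologicalSpace Z] : Prop :=
  ∃ Y : Set (BaireStar k), Dense Y ∧ IsAI k ↥Y ∧ Nonempty (Z ≃ₜ ↥(Yᶜ))

/-- `X ∈ 𝓕_σδ ∖ σLW(<k)`: `X` is homeomorphic to `F ∖ L` for some absolute
`F_σδ`-space `F` and some `L ⊆ F` with `L ∈ σLW(<k)`. -/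
def FsdMinusSLW (X : Type u) [TopologicalSpace X] (k : Cardinal.{u}) : Prop :=
  ∃ (F : TopCat.{u}) (L : Set F), AbsFsigmaDelta ↥F ∧ SigmaLW ↥L k ∧
    Nonempty (X ≃ₜ ↥(Lᶜ))

/-- No nonempty open subspace is in the class `𝓕_σδ ∖ σLW(<k)`. -/
def NowhereFsdMinusSLW (X : Type u) [TopologicalSpace X] (k : Cardinal.{u}) : Prop :=
  ∀ U : Set X, IsOpen U → U.Nonempty → ¬ FsdMinusSLW ↥U k

/-- A topologically complete (i.e. completely metrizable) space. -/
def CompletelyMetrizable (X : Type*) [t : TopologicalSpace X] : Prop :=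
  ∃ m : MetricSpace X, m.toUniformSpace.toTopologicalSpace = t ∧
    @CompleteSpace X m.toUniformSpace

end

set_option linter.unusedSectionVars false

namespace AIIproof

section Cyl
variable {S : Type u} [TopologicalSpace S] [DiscreteTopology S]

/-- The cylinder of sequences agreeing with `x` below `n`. -/
def cyl {S : Type u} (x : ℕ → S) (n : ℕ) : Set (ℕ → S) := {y | ∀ i < n, y i = x i}

lemma self_mem_cyl (x : ℕ → S) (n : ℕ) : x ∈ cyl x n := fun _ _ => rfl

lemma cyl_eq {x y : ℕ → S} {n : ℕ} (h : y ∈ cyl x n) : cyl y n = cyl x n := by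
  ext z
  constructor
  · intro hz i hi
    rw [hz i hi, h i hi]
  · intro hz i hi
    rw [hz i hi, h i hi]

lemma cyl_anti (x : ℕ → S) {m n : ℕ} (h : m ≤ n) : cyl x n ⊆ cyl x m :=
  fun _ hz i hi => hz i (lt_of_lt_of_le hi h)

lemma cyl_clopen (x : ℕ → S) (n : ℕ) : IsClopen (cyl x n) := by
  have : cyl x n = ⋂ i ∈ Finset.range n, (fun y : ℕ → S => y i) ⁻¹' {x i} := by
    ext y
    simp [cyl]
  rw [this]
  apply Set.Finite.isClopen_biInter (Finset.finite_toSet _)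
  intro i _
  exact (isClopen_discrete _).preimage (continuous_apply i)

lemma exists_cyl_subset {U : Set (ℕ → S)} (hU : IsOpen U) {x : ℕ → S} (hx : x ∈ U) :
    ∃ n, cyl x n ⊆ U := by
  rw [isOpen_pi_iff] at hU
  obtain ⟨I, u, h1, h2⟩ := hU x hx
  obtain ⟨n, hn⟩ := I.exists_nat_subset_range
  refine ⟨n, fun y hy => h2 ?_⟩
  intro i hi
  have := hn hi
  rw [hy i (Finset.mem_range.mp this)]
  exact (h1 i hi).2

/-- being a cylinder -/
def IsCyl {S : Type u} (V : Set (ℕ → S)) : Prop := ∃ x n, V = cyl x n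

lemma IsCyl.clopen {V : Set (ℕ → S)} (h : IsCyl V) : IsClopen V := by
  obtain ⟨x, n, rfl⟩ := h
  exact cyl_clopen x n

/-- The family of maximal cylinders with the property `p`. -/
def hit {S : Type u} (p : Set (ℕ → S) → Prop) : Set (Set (ℕ → S)) :=
  {V | ∃ x n, V = cyl x n ∧ p V ∧ ∀ m < n, ¬ p (cyl x m)}

lemma hit_cyl {p : Set (ℕ → S) → Prop} {V} (h : V ∈ hit p) : IsCyl V := by
  obtain ⟨x, n, h, -⟩ := h
  exact ⟨x, n, h⟩

lemma hit_p {p : Set (ℕ → S) → Prop} {V} (h : V ∈ hit p) : p V := by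
  obtain ⟨x, n, _, h, -⟩ := h
  exact h

lemma hit_eq {p : Set (ℕ → S) → Prop} {V W} (hV : V ∈ hit p) (hW : W ∈ hit p) {z}
    (zV : z ∈ V) (zW : z ∈ W) : V = W := by
  obtain ⟨x, n, rfl, h1, h2⟩ := hV
  obtain ⟨y, m, rfl, h3, h4⟩ := hW
  rw [← cyl_eq zV] at h1 ⊢
  rw [← cyl_eq zW] at h3 ⊢
  rcases lt_trichotomy n m with h | h | h
  · exfalso
    apply h4 n h
    rwa [← cyl_eq (cyl_anti y h.le zW)]
  · rw [h]
  · exfalso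
    apply h2 m h
    rwa [← cyl_eq (cyl_anti x h.le zV)]

lemma hit_disj (p : Set (ℕ → S) → Prop) : (hit p).PairwiseDisjoint id := by
  intro V hV W hW hne
  rw [Function.onFun, Set.disjoint_left]
  intro z zV zW
  exact hne (hit_eq hV hW zV zW)

lemma exists_hit {p : Set (ℕ → S) → Prop} {x : ℕ → S} {n : ℕ} (h : p (cyl x n)) :
    ∃ m ≤ n, cyl x m ∈ hit p := by
  classical
  have h' : ∃ n, p (cyl x n) := ⟨n, h⟩
  refine ⟨Nat.find h', Nat.find_min' h' h, x, _, rfl, Nat.find_spec h', ?_⟩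
  intro m hm
  exact Nat.find_min h' hm

lemma sUnion_hit (p : Set (ℕ → S) → Prop) : ⋃₀ hit p = {x | ∃ n, p (cyl x n)} := by
  ext x
  constructor
  · rintro ⟨V, hV, hx⟩
    obtain ⟨y, n, rfl, h1, -⟩ := hV
    refine ⟨n, ?_⟩
    rwa [cyl_eq hx]
  · rintro ⟨n, hn⟩
    obtain ⟨m, -, hm⟩ := exists_hit hn
    exact ⟨_, hm, self_mem_cyl x m⟩

/-- Gluing `Gδ` sets along a disjoint open family. -/
lemma glue_gdelta {T : Set (Set (ℕ → S))} (ho : ∀ t ∈ T, IsOpen t)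
    (hd : T.PairwiseDisjoint id) (G : Set (ℕ → S) → Set (ℕ → S)) (hG : ∀ t ∈ T, IsGδ (G t)) :
    IsGδ (⋃ t ∈ T, G t ∩ t) := by
  have : ∀ t ∈ T, ∃ f : ℕ → Set (ℕ → S), (∀ n, IsOpen (f n)) ∧ G t = ⋂ n, f n := by
    intro t ht
    exact isGδ_iff_eq_iInter_nat.mp (hG t ht)
  choose! f hf1 hf2 using this
  have key : (⋃ t ∈ T, G t ∩ t) = ⋂ n, ⋃ t ∈ T, f t n ∩ t := by
    ext x
    simp only [mem_iUnion, mem_iInter, mem_inter_iff, exists_prop]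
    constructor
    · rintro ⟨t, ht, h1, h2⟩ n
      rw [hf2 t ht] at h1
      exact ⟨t, ht, mem_iInter.mp h1 n, h2⟩
    · intro h
      obtain ⟨t, ht, h1, h2⟩ := h 0
      refine ⟨t, ht, ?_, h2⟩
      rw [hf2 t ht, mem_iInter]
      intro n
      obtain ⟨s, hs, h3, h4⟩ := h n
      have : s = t := by
        by_contra hne
        exact Set.disjoint_left.mp (hd hs ht hne) h4 h2
      rwa [← this]
  rw [key]
  apply IsGδ.iInter_of_isOpen
  intro n
  exact isOpen_biUnion fun t ht => (hf1 t ht n).inter (ho t ht)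

end Cyl

section Core
variable {S : Type u} [TopologicalSpace S] [DiscreteTopology S]

/-- The abstract properties of the ideal we work with. -/
structure IdealAx (A : Set (ℕ → S)) (k : Cardinal.{u}) (I : Set (ℕ → S) → Prop) : Prop where
  mono : ∀ P Q, I P → Q ⊆ P → I Q
  union : ∀ P : ℕ → Set (ℕ → S), (∀ n, I (P n)) → I (⋃ n, P n)
  gd : ∀ G, IsGδ G → G ⊆ A → I G
  glue : ∀ (P : Set (ℕ → S)) (T : Set (Set (ℕ → S))), (∀ t ∈ T, IsOpen t) →
    T.PairwiseDisjoint id → (∀ t ∈ T, I (P ∩ t)) → I (P ∩ ⋃₀ T)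
  small : ∀ P : Set (ℕ → S), WeightLT ↥P k → I P

lemma IdealAx.union2 {A : Set (ℕ → S)} {k : Cardinal.{u}} {I : Set (ℕ → S) → Prop}
    (h : IdealAx A k I) {P Q : Set (ℕ → S)} (hP : I P) (hQ : I Q) : I (P ∪ Q) := by
  refine h.mono _ _ (h.union (fun n => if n = 0 then P else Q) ?_) ?_
  · intro n
    split_ifs <;> assumption
  · rintro x (hx | hx)
    · exact mem_iUnion.mpr ⟨0, by simpa using hx⟩
    · exact mem_iUnion.mpr ⟨1, by simpa using hx⟩

/-- `K` is nowhere dense in `M` (used for closed `K`). -/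
def Nwd (K M : Set (ℕ → S)) : Prop :=
  ∀ V, IsOpen V → (V ∩ M).Nonempty → ((V ∩ M) \ K).Nonempty

/-- witness of meagerness of `A ∩ M` in `M`. -/
def Wit (A M : Set (ℕ → S)) (K : ℕ → Set (ℕ → S)) : Prop :=
  Monotone K ∧ (∀ m, IsClosed (K m)) ∧ A ∩ M ⊆ (⋃ m, K m) ∧ ∀ m, Nwd (K m) M

/-- the good closed sets -/
structure Good (A : Set (ℕ → S)) (I : Set (ℕ → S) → Prop) (M : Set (ℕ → S)) : Prop where
  closed : IsClosed M
  ne : M.Nonempty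
  pos : ∀ V, IsOpen V → (V ∩ M).Nonempty → ¬ I (A ∩ (V ∩ M))
  wit : ∃ K, Wit A M K

/-- A presentation of `A` as an `F_σδ` set. -/
structure Pres (A : Set (ℕ → S)) (C : ℕ → ℕ → Set (ℕ → S)) : Prop where
  closed : ∀ n m, IsClosed (C n m)
  mono : ∀ n, Monotone (C n)
  eq : A = ⋂ n, ⋃ m, C n m

lemma exists_good {A : Set (ℕ → S)} {k : Cardinal.{u}} {I : Set (ℕ → S) → Prop}
    {C : ℕ → ℕ → Set (ℕ → S)} (hI : IdealAx A k I) (hC : Pres A C)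
    {E : Set (ℕ → S)} (hE : IsClosed E) (hAE : ¬ I (A ∩ E)) : ∃ M ⊆ E, Good A I M := by
  classical
  let p : ℕ → Set (ℕ → S) → Prop := fun n V => ∃ P D, I P ∧ IsGδ D ∧ D ⊆ (⋃ m, C n m) ∧
    A ∩ E ∩ V ⊆ P ∪ D
  let W : ℕ → Set (ℕ → S) := fun n => ⋃₀ hit (p n)
  have hWo : ∀ n, IsOpen (W n) := fun n => isOpen_sUnion fun t ht => (hit_cyl ht).clopen.isOpen
  have hW : ∀ n, p n (W n) := by
    intro n
    have h1 : ∀ t ∈ hit (p n), p n t := fun t ht => hit_p ht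
    choose! P D hP hD hDC hsub using h1
    refine ⟨(⋃ t ∈ hit (p n), P t ∩ t) ∩ ⋃₀ hit (p n), ⋃ t ∈ hit (p n), D t ∩ t, ?_, ?_, ?_, ?_⟩
    · apply hI.glue _ _ (fun t ht => (hit_cyl ht).clopen.isOpen) (hit_disj _)
      intro t ht
      apply hI.mono _ _ (hP t ht)
      rintro x ⟨hx, hxt⟩
      simp only [mem_iUnion] at hx
      obtain ⟨s, hs, h3, h4⟩ := hx
      rwa [hit_eq ht hs hxt h4]
    · exact glue_gdelta (fun t ht => (hit_cyl ht).clopen.isOpen) (hit_disj _) _ hD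
    · intro x hx
      simp only [mem_iUnion] at hx
      obtain ⟨s, hs, h3, h4⟩ := hx
      exact hDC s hs h3
    · rintro x ⟨hx, t, ht, hxt⟩
      rcases hsub t ht ⟨hx, hxt⟩ with h | h
      · left
        exact ⟨by simp only [mem_iUnion]; exact ⟨t, ht, h, hxt⟩, t, ht, hxt⟩
      · right
        simp only [mem_iUnion]; exact ⟨t, ht, h, hxt⟩
  by_cases hall : ∀ n, E ⊆ W n
  · exfalso
    apply hAE
    choose P D hP hD hDC hsub using hW
    refine hI.mono _ _ (hI.union2 (hI.union P hP) (hI.gd (⋂ n, D n) (IsGδ.iInter hD) ?_)) ?_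
    · rw [hC.eq]
      exact iInter_mono hDC
    · rintro x ⟨hxA, hxE⟩
      by_cases hx : ∃ n, x ∈ P n
      · left; exact mem_iUnion.mpr hx
      · right
        push Not at hx
        rw [mem_iInter]
        intro n
        rcases hsub n ⟨⟨hxA, hxE⟩, hall n hxE⟩ with h | h
        · exact absurd h (hx n)
        · exact h
  · push Not at hall
    obtain ⟨n, hn⟩ := hall
    obtain ⟨P, D, hP, hD, hDC, hsub⟩ := hW n
    obtain ⟨x0, hx0E, hx0W⟩ := Set.not_subset.mp hn
    have hno : ∀ x ∈ E \ W n, ∀ j, ¬ p n (cyl x j) := by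
      intro x hx j hj
      apply hx.2
      show x ∈ ⋃₀ hit (p n)
      rw [sUnion_hit]
      exact ⟨j, hj⟩
    have hMc : IsClosed (E \ W n) := hE.sdiff (hWo n)
    refine ⟨E \ W n, sdiff_subset, hMc, ⟨x0, hx0E, hx0W⟩, ?_, C n, hC.mono n, hC.closed n, ?_, ?_⟩
    · rintro V hV ⟨x, hxV, hxM⟩ hbad
      obtain ⟨j, hj⟩ := exists_cyl_subset hV hxV
      apply hno x hxM j
      refine ⟨P ∪ (A ∩ (V ∩ (E \ W n))), D, hI.union2 hP hbad, hD, hDC, ?_⟩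
      rintro y ⟨⟨hyA, hyE⟩, hyV⟩
      by_cases hyW : y ∈ W n
      · rcases hsub ⟨⟨hyA, hyE⟩, hyW⟩ with h | h
        · left; left; exact h
        · right; exact h
      · left; right; exact ⟨hyA, hj hyV, hyE, hyW⟩
    · intro x hx
      have := hx.1
      rw [hC.eq] at this
      exact mem_iInter.mp this n
    · rintro m V hV ⟨x, hxV, hxM⟩
      by_contra hne
      rw [Set.not_nonempty_iff_eq_empty, Set.sdiff_eq_empty] at hne
      obtain ⟨j, hj⟩ := exists_cyl_subset hV hxV
      apply hno x hxM j
      refine ⟨P, cyl x j ∩ ((W n ∩ D) ∪ (E \ W n)), hP, ?_, ?_, ?_⟩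
      · exact (cyl_clopen x j).isOpen.isGδ.inter
          (((hWo n).isGδ.inter hD).union hMc.isGδ)
      · rintro y ⟨hy1, hy2 | hy2⟩
        · exact hDC hy2.2
        · exact mem_iUnion.mpr ⟨m, hne ⟨hj hy1, hy2⟩⟩
      · rintro y ⟨⟨hyA, hyE⟩, hyV⟩
        by_cases hyW : y ∈ W n
        · rcases hsub ⟨⟨hyA, hyE⟩, hyW⟩ with h | h
          · left; exact h
          · right; exact ⟨hyV, Or.inl ⟨hyW, h⟩⟩
        · right; exact ⟨hyV, Or.inr ⟨hyE, hyW⟩⟩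

end Core
end AIIproof

namespace AIIproof
section Designate
variable {S : Type u} [TopologicalSpace S] [DiscreteTopology S]

lemma exists_exit {E : Set (ℕ → S)} (hE : IsClosed E) {x : ℕ → S} (hx : x ∉ E) :
    ∃ n, cyl x n ∈ hit (fun V => V ∩ E = ∅) := by
  obtain ⟨n, hn⟩ := exists_cyl_subset hE.isOpen_compl hx
  obtain ⟨m, -, hm⟩ := exists_hit (p := fun V => V ∩ E = ∅) (x := x) (n := n) (by
    rw [Set.eq_empty_iff_forall_notMem]
    rintro y ⟨h1, h2⟩
    exact hn h1 h2)
  exact ⟨m, hm⟩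

lemma mem_glue_iff {E : Set (ℕ → S)} {T : Set (Set (ℕ → S))}
    (hT : T ⊆ hit (fun V => V ∩ E = ∅)) {N : Set (ℕ → S) → Set (ℕ → S)}
    (hNt : ∀ t ∈ T, N t ⊆ t) {t} (ht : t ∈ T) {y} (hy : y ∈ t) :
    y ∈ E ∪ (⋃ t ∈ T, N t) ↔ y ∈ N t := by
  constructor
  · rintro (h | h)
    · exfalso
      have : t ∩ E = ∅ := hit_p (p := fun V => V ∩ E = ∅) (hT ht)
      exact Set.eq_empty_iff_forall_notMem.mp this y ⟨hy, h⟩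
    · simp only [mem_iUnion] at h
      obtain ⟨s, hs, hys⟩ := h
      rwa [hit_eq (hT ht) (hT hs) hy (hNt s hs hys)]
  · intro h
    right
    simp only [mem_iUnion]
    exact ⟨t, ht, h⟩

lemma closed_glue {E : Set (ℕ → S)} (hE : IsClosed E) {T : Set (Set (ℕ → S))}
    (hT : T ⊆ hit (fun V => V ∩ E = ∅)) {N : Set (ℕ → S) → Set (ℕ → S)}
    (hNt : ∀ t ∈ T, N t ⊆ t) (hN : ∀ t ∈ T, IsClosed (N t)) :
    IsClosed (E ∪ ⋃ t ∈ T, N t) := by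
  rw [← isOpen_compl_iff, isOpen_iff_mem_nhds]
  intro x hx
  have hxE : x ∉ E := fun h => hx (Or.inl h)
  obtain ⟨n, hn⟩ := exists_exit hE hxE
  by_cases hT' : cyl x n ∈ T
  · have hxN : x ∉ N (cyl x n) := fun h => hx ((mem_glue_iff hT hNt hT' (self_mem_cyl x n)).mpr h)
    filter_upwards [(cyl_clopen x n).isOpen.mem_nhds (self_mem_cyl x n),
      (hN _ hT').isOpen_compl.mem_nhds hxN] with y h1 h2 h3
    exact h2 ((mem_glue_iff hT hNt hT' h1).mp h3)
  · filter_upwards [(cyl_clopen x n).isOpen.mem_nhds (self_mem_cyl x n)] with y h1 h3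
    rcases h3 with h3 | h3
    · have : cyl x n ∩ E = ∅ := hit_p (p := fun V => V ∩ E = ∅) hn
      exact Set.eq_empty_iff_forall_notMem.mp this y ⟨h1, h3⟩
    · simp only [mem_iUnion] at h3
      obtain ⟨s, hs, hys⟩ := h3
      apply hT'
      rwa [hit_eq hn (hT hs) h1 (hNt s hs hys)]

lemma designate {A : Set (ℕ → S)} {k : Cardinal.{u}} {I : Set (ℕ → S) → Prop}
    {C : ℕ → ℕ → Set (ℕ → S)} (hI : IdealAx A k I) (hC : Pres A C)
    {M K : Set (ℕ → S)} (hM : Good A I M) (hK : IsClosed K) (hKM : Nwd K M) (i m : ℕ) :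
    ∃ Y ⊆ M, Good A I Y ∧ Nwd Y M ∧ Y ⊆ (⋃ m, C i m) ∧ M ∩ K ∩ C i m ⊆ Y := by
  classical
  set E : Set (ℕ → S) := M ∩ K ∩ C i m with hEdef
  have hE : IsClosed E := (hM.closed.inter hK).inter (hC.closed i m)
  let T : Set (Set (ℕ → S)) := {t | t ∈ hit (fun V => V ∩ E = ∅) ∧ (t ∩ M).Nonempty}
  have hT : T ⊆ hit (fun V => V ∩ E = ∅) := fun t ht => ht.1
  have hTo : ∀ t ∈ T, IsOpen t := fun t ht => (hit_cyl ht.1).clopen.isOpen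
  obtain ⟨KM, hKMmono, hKMc, hKMcov, hKMnwd⟩ := hM.wit
  have hex : ∀ t ∈ T, ∃ N, N ⊆ t ∧ N ⊆ M ∧ Good A I N ∧ Nwd N M ∧ N ⊆ (⋃ m, C i m) := by
    intro t ht
    have h1 : ∃ a, ¬ I (A ∩ (t ∩ M ∩ KM a ∩ C i a)) := by
      by_contra hcon
      push Not at hcon
      apply hM.pos t (hTo t ht) ht.2
      apply hI.mono _ _ (hI.union _ hcon)
      rintro x ⟨hxA, hxt, hxM⟩
      obtain ⟨a, ha⟩ := mem_iUnion.mp (hKMcov ⟨hxA, hxM⟩)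
      have hxA' := hxA
      rw [hC.eq] at hxA'
      obtain ⟨b, hb⟩ := mem_iUnion.mp (mem_iInter.mp hxA' i)
      refine mem_iUnion.mpr ⟨max a b, hxA, ⟨⟨hxt, hxM⟩, ?_⟩, ?_⟩
      · exact hKMmono (le_max_left a b) ha
      · exact hC.mono i (le_max_right a b) hb
    obtain ⟨a, ha⟩ := h1
    have hcl : IsClosed (t ∩ M ∩ KM a ∩ C i a) :=
      (((hit_cyl ht.1).clopen.isClosed.inter hM.closed).inter (hKMc a)).inter (hC.closed i a)
    obtain ⟨N, hNsub, hNgood⟩ := exists_good hI hC hcl ha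
    refine ⟨N, fun x hx => (hNsub hx).1.1.1, fun x hx => (hNsub hx).1.1.2, hNgood, ?_, ?_⟩
    · intro V hV hne
      obtain ⟨x, hx, hxn⟩ := hKMnwd a V hV hne
      exact ⟨x, hx, fun h => hxn (hNsub h).1.2⟩
    · intro x hx
      exact mem_iUnion.mpr ⟨a, (hNsub hx).2⟩
  choose! N hNt hNM hNgood hNnwd hNC using hex
  have hKN : ∀ t ∈ T, ∃ K, Wit A (N t) K := fun t ht => (hNgood t ht).wit
  choose! KN hKNmono hKNc hKNcov hKNnwd using hKN
  -- every open set meeting `M` contains a point of `M` outside `E`, lying in a member of `T`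
  have hexit : ∀ V, IsOpen V → (V ∩ M).Nonempty → ∃ t ∈ T, (V ∩ t ∩ M).Nonempty := by
    intro V hV hne
    obtain ⟨x, hx, hxK⟩ := hKM V hV hne
    have hxE : x ∉ E := fun h => hxK h.1.2
    obtain ⟨n, hn⟩ := exists_exit hE hxE
    exact ⟨cyl x n, ⟨hn, x, self_mem_cyl x n, hx.2⟩, x, ⟨hx.1, self_mem_cyl x n⟩, hx.2⟩
  have hYM : E ∪ (⋃ t ∈ T, N t) ⊆ M := by
    rintro x (h | h)
    · exact h.1.1
    · simp only [mem_iUnion] at h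
      obtain ⟨s, hs, hys⟩ := h
      exact hNM s hs hys
  have hmeet : ∀ V, IsOpen V → (V ∩ (E ∪ ⋃ t ∈ T, N t)).Nonempty → ∃ t ∈ T, (V ∩ N t).Nonempty := by
    rintro V hV ⟨x, hxV, hx | hx⟩
    · obtain ⟨n, hn⟩ := exists_cyl_subset hV hxV
      obtain ⟨z, hz, hzK⟩ := hKM (cyl x n) (cyl_clopen x n).isOpen ⟨x, self_mem_cyl x n, hx.1.1⟩
      have hzE : z ∉ E := fun h => hzK h.1.2
      obtain ⟨l, hl⟩ := exists_exit hE hzE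
      have hlT : cyl z l ∈ T := ⟨hl, z, self_mem_cyl z l, hz.2⟩
      have hnl : n ≤ l := by
        by_contra hlt
        push Not at hlt
        have h1 : cyl z l ∩ E = ∅ := hit_p (p := fun V => V ∩ E = ∅) hl
        apply Set.eq_empty_iff_forall_notMem.mp h1 x
        refine ⟨?_, hx⟩
        have : x ∈ cyl z n := by
          rw [cyl_eq hz.1]; exact self_mem_cyl x n
        exact cyl_anti z hlt.le this
      refine ⟨cyl z l, hlT, ?_⟩
      obtain ⟨y, hy⟩ := (hNgood _ hlT).ne
      refine ⟨y, hn ?_, hy⟩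
      have := cyl_anti z hnl (hNt _ hlT hy)
      rwa [cyl_eq hz.1] at this
    · simp only [mem_iUnion] at hx
      obtain ⟨s, hs, hys⟩ := hx
      exact ⟨s, hs, x, hxV, hys⟩
  refine ⟨E ∪ ⋃ t ∈ T, N t, hYM, ⟨?_, ?_, ?_, ?_⟩, ?_, ?_, ?_⟩
  · exact closed_glue hE hT hNt (fun t ht => (hNgood t ht).closed)
  · obtain ⟨t, ht, -⟩ := hexit univ isOpen_univ (by simpa using hM.ne)
    obtain ⟨y, hy⟩ := (hNgood t ht).ne
    exact ⟨y, (mem_glue_iff hT hNt ht (hNt t ht hy)).mpr hy⟩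
  · intro V hV hne hbad
    obtain ⟨t, ht, hne'⟩ := hmeet V hV hne
    apply (hNgood t ht).pos V hV hne'
    apply hI.mono _ _ hbad
    rintro x ⟨hxA, hxV, hxN⟩
    exact ⟨hxA, hxV, (mem_glue_iff hT hNt ht (hNt t ht hxN)).mpr hxN⟩
  · refine ⟨fun a => E ∪ ⋃ t ∈ T, (N t ∩ KN t a), ?_, ?_, ?_, ?_⟩
    · intro a b hab
      apply union_subset_union_right
      exact iUnion₂_mono fun t ht => inter_subset_inter_right _ (hKNmono t ht hab)
    · intro a
      exact closed_glue hE hT (N := fun t => N t ∩ KN t a) (fun t ht x hx => hNt t ht hx.1)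
        (fun t ht => (hNgood t ht).closed.inter (hKNc t ht a))
    · rintro x ⟨hxA, hx | hx⟩
      · exact mem_iUnion.mpr ⟨0, Or.inl hx⟩
      · simp only [mem_iUnion] at hx
        obtain ⟨s, hs, hys⟩ := hx
        obtain ⟨a, ha⟩ := mem_iUnion.mp (hKNcov s hs ⟨hxA, hys⟩)
        refine mem_iUnion.mpr ⟨a, Or.inr ?_⟩
        simp only [mem_iUnion]
        exact ⟨s, hs, hys, ha⟩
    · intro a V hV hne
      obtain ⟨t, ht, hne'⟩ := hmeet V hV hne
      obtain ⟨x, ⟨hxV, hxN⟩, hxK⟩ := hKNnwd t ht a V hV hne'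
      refine ⟨x, ⟨hxV, (mem_glue_iff hT hNt ht (hNt t ht hxN)).mpr hxN⟩, ?_⟩
      intro hx
      have := (mem_glue_iff hT (N := fun t => N t ∩ KN t a) (fun t ht x hx => hNt t ht hx.1)
        ht (hNt t ht hxN)).mp hx
      exact hxK this.2
  · intro V hV hne
    obtain ⟨t, ht, hne'⟩ := hexit V hV hne
    obtain ⟨x, ⟨⟨hxV, hxt⟩, hxM⟩, hxN⟩ := hNnwd t ht (V ∩ t) (hV.inter (hTo t ht)) hne'
    exact ⟨x, ⟨hxV, hxM⟩, fun h => hxN ((mem_glue_iff hT hNt ht hxt).mp h)⟩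
  · rintro x (h | h)
    · exact mem_iUnion.mpr ⟨m, h.2⟩
    · simp only [mem_iUnion] at h
      obtain ⟨s, hs, hys⟩ := h
      exact hNC s hs hys
  · exact subset_union_left

/-- Restriction of good sets to clopen sets. -/
lemma Good.restrict {A : Set (ℕ → S)} {I : Set (ℕ → S) → Prop}
    {M V : Set (ℕ → S)} (hM : Good A I M) (hV : IsClopen V) (hne : (V ∩ M).Nonempty) :
    Good A I (V ∩ M) := by
  refine ⟨hV.isClosed.inter hM.closed, hne, ?_, ?_⟩
  · intro W hW hWne
    rw [← inter_assoc W V M] at hWne ⊢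
    exact hM.pos _ (hW.inter hV.isOpen) hWne
  · obtain ⟨K, h1, h2, h3, h4⟩ := hM.wit
    refine ⟨K, h1, h2, fun x hx => h3 ⟨hx.1, hx.2.2⟩, ?_⟩
    intro m W hW hWne
    rw [← inter_assoc] at hWne ⊢
    exact h4 m _ (hW.inter hV.isOpen) hWne

lemma Nwd.restrict {M V K : Set (ℕ → S)} (h : Nwd K M) (hV : IsOpen V) : Nwd K (V ∩ M) := by
  intro W hW hWne
  rw [← inter_assoc] at hWne ⊢
  exact h _ (hW.inter hV) hWne

end Designate
end AIIproof

namespace AIIproof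
section Count
variable {S : Type u} [TopologicalSpace S] [DiscreteTopology S]

/-- The cylinders of level `n` meeting `P`. -/
def cnt {S : Type u} (n : ℕ) (P : Set (ℕ → S)) : Set (Set (ℕ → S)) := (fun x => cyl x n) '' P

lemma cnt_mono (P : Set (ℕ → S)) {m n : ℕ} (h : m ≤ n) :
    Cardinal.mk (cnt m P) ≤ Cardinal.mk (cnt n P) := by
  have h1 : ∀ t : cnt m P, ∃ x ∈ P, cyl x m = t.1 := fun t => t.2
  choose f hf1 hf2 using h1
  refine Cardinal.mk_le_of_injective (f := fun t => (⟨cyl (f t) n, f t, hf1 t, rfl⟩ : cnt n P)) ?_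
  intro t t' htt
  have h2 : cyl (f t) n = cyl (f t') n := congrArg Subtype.val htt
  apply Subtype.ext
  rw [← hf2 t, ← hf2 t']
  apply cyl_eq
  apply cyl_anti _ h
  rw [← h2]
  exact self_mem_cyl _ _

/-- `P` has at least `k`-many cylinders. -/
def Thick (k : Cardinal.{u}) (P : Set (ℕ → S)) : Prop :=
  ∀ l < k, ∃ n, l < Cardinal.mk (cnt n P)

lemma weightLT_of_finite {X : Type u} [TopologicalSpace X] [Finite X] {k : Cardinal.{u}}
    (hk : Cardinal.aleph0 ≤ k) : WeightLT X k := by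
  refine ⟨{U | IsOpen U}, TopologicalSpace.isTopologicalBasis_opens, ?_⟩
  refine lt_of_lt_of_le ?_ hk
  exact Cardinal.lt_aleph0_of_finite _

lemma thick_of_not_weightLT {k : Cardinal.{u}} (hk : Cardinal.aleph0 ≤ k) {P : Set (ℕ → S)}
    (h : ¬ WeightLT ↥P k) : Thick k P := by
  intro l hl
  by_contra hcon
  push Not at hcon
  apply h
  rcases hk.eq_or_lt with hk' | hk'
  · -- countable case : P is finite
    have : P.Finite := by
      by_contra hinf
      rw [← hk'] at hl
      obtain ⟨a, rfl⟩ := Cardinal.lt_aleph0.mp hl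
      obtain ⟨s, hs, hcard⟩ := Set.Infinite.exists_subset_card_eq (s := P) hinf (a + 1)
      have hsep : ∀ p : (ℕ → S) × (ℕ → S), ∃ n, p.1 ≠ p.2 → p.1 n ≠ p.2 n := by
        rintro ⟨x, y⟩
        by_cases hxy : x = y
        · exact ⟨0, fun h => absurd hxy h⟩
        · obtain ⟨n, hn⟩ := Function.ne_iff.mp hxy
          exact ⟨n, fun _ => hn⟩
      choose g hg using hsep
      let n := (s ×ˢ s).sup g + 1
      have hinj : Set.InjOn (fun x => cyl x n) (s : Set (ℕ → S)) := by
        intro x hx y hy hxy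
        by_contra hne
        apply hg (x, y) hne
        have h1 : x ∈ cyl y n := by
          have : cyl x n = cyl y n := hxy
          rw [← this]; exact self_mem_cyl x n
        apply h1
        have : g (x, y) ≤ (s ×ˢ s).sup g := Finset.le_sup (f := g) (by
          rw [Finset.mem_product]; exact ⟨hx, hy⟩)
        exact Nat.lt_succ_of_le this
      have h2 : Cardinal.mk (s : Set (ℕ → S)) ≤ Cardinal.mk (cnt n P) := by
        rw [← Cardinal.mk_image_eq_of_injOn _ _ hinj]
        exact Cardinal.mk_le_mk_of_subset (image_mono hs)
      have h3 := h2.trans (hcon n)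
      have h4 : Cardinal.mk (s : Set (ℕ → S)) = (s.card : Cardinal) := Cardinal.mk_coe_finset
      rw [h4, hcard] at h3
      exact absurd (Nat.cast_le.mp h3) (by omega)
    haveI := this.to_subtype
    exact weightLT_of_finite hk
  · refine ⟨⋃ n, (fun t => Subtype.val ⁻¹' t) '' cnt n P, ?_, ?_⟩
    · apply TopologicalSpace.isTopologicalBasis_of_isOpen_of_nhds
      · intro U hU
        obtain ⟨n, hn⟩ := mem_iUnion.mp hU
        obtain ⟨t, ⟨x, -, rfl⟩, rfl⟩ := hn
        exact (cyl_clopen x n).isOpen.preimage continuous_subtype_val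
      · rintro ⟨x, hx⟩ U hxU hU
        obtain ⟨V, hV, rfl⟩ := isOpen_induced_iff.mp hU
        obtain ⟨n, hn⟩ := exists_cyl_subset hV (x := x) hxU
        refine ⟨_, mem_iUnion.mpr ⟨n, cyl x n, ⟨x, hx, rfl⟩, rfl⟩, self_mem_cyl x n, ?_⟩
        exact preimage_mono hn
    · have h1 : Cardinal.mk (⋃ n, (fun t => (Subtype.val ⁻¹' t : Set ↥P)) '' cnt n P)
          ≤ Cardinal.sum (fun n : ℕ => Cardinal.mk
            ((fun t => (Subtype.val ⁻¹' t : Set ↥P)) '' cnt n P)) := by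
        have := Cardinal.mk_iUnion_le_sum_mk_lift
          (f := fun n : ℕ => (fun t => (Subtype.val ⁻¹' t : Set ↥P)) '' cnt n P)
        simpa using this
      have h2 : Cardinal.sum (fun n : ℕ => Cardinal.mk
            ((fun t => (Subtype.val ⁻¹' t : Set ↥P)) '' cnt n P)) ≤
            Cardinal.sum (fun _ : ℕ => l) :=
        Cardinal.sum_le_sum _ _ fun n => Cardinal.mk_image_le.trans (hcon n)
      refine (h1.trans h2).trans_lt ?_
      rw [Cardinal.sum_const]
      simp only [Cardinal.mk_nat, Cardinal.lift_aleph0, Cardinal.lift_id, Cardinal.lift_uzero]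
      exact Cardinal.mul_lt_of_lt hk hk' hl

lemma sum_choice {k : Cardinal.{u}} (a : ℕ → ℕ → Cardinal.{u}) (ha : ∀ l, Monotone (a l))
    (h : ∀ l, ∀ c < k, ∃ n, c < a l n) (N : ℕ) :
    ∃ f : ℕ → ℕ, (∀ l, N ≤ f l) ∧ k ≤ Cardinal.sum (fun l => a l (f l)) := by
  classical
  by_cases h0 : ∃ n, k ≤ a 0 n
  · obtain ⟨n, hn⟩ := h0
    refine ⟨fun _ => max n N, fun _ => le_max_right _ _, ?_⟩
    exact (hn.trans (ha 0 (le_max_left n N))).trans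
      (by simpa using Cardinal.le_sum (fun l => a l (max n N)) 0)
  · push Not at h0
    have h1 : ∀ l, ∃ n, N ≤ n ∧ a 0 l < a l n := by
      intro l
      obtain ⟨n, hn⟩ := h l _ (h0 l)
      exact ⟨max N n, le_max_left _ _, hn.trans_le (ha l (le_max_right _ _))⟩
    choose f hf1 hf2 using h1
    refine ⟨f, hf1, ?_⟩
    by_contra hlt
    push Not at hlt
    obtain ⟨n, hn⟩ := h 0 _ hlt
    have h3 : a n (f n) ≤ Cardinal.sum (fun l => a l (f l)) := by
      simpa using Cardinal.le_sum (fun l => a l (f l)) n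
    exact absurd (hn.trans (hf2 n)) (not_lt.mpr h3)

/-- All elements agree below `N`. -/
def Small {S : Type u} (N : ℕ) (t : Set (ℕ → S)) : Prop := ∀ x ∈ t, ∀ y ∈ t, ∀ i < N, x i = y i

lemma small_cyl {x : ℕ → S} {n N : ℕ} (h : N ≤ n) : Small N (cyl x n) := by
  intro y hy z hz i hi
  rw [hy i (by omega), hz i (by omega)]

lemma refine_family {k : Cardinal.{u}} (P : Set (ℕ → S)) (T : Set (Set (ℕ → S)))
    (hT : ∀ t ∈ T, IsCyl t) (hd : T.PairwiseDisjoint id) (e : ℕ → Set (ℕ → S))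
    (he : Function.Injective e) (heT : ∀ l, e l ∈ T) (hth : ∀ l, Thick k (P ∩ e l)) (N : ℕ) :
    ∃ R : Set (Set (ℕ → S)), (∀ t ∈ R, IsCyl t ∧ Small N t ∧ ∃ s ∈ T, t ⊆ s) ∧
      R.PairwiseDisjoint id ∧ ⋃₀ R = ⋃₀ T ∧
      k ≤ Cardinal.mk {t | t ∈ R ∧ (t ∩ P).Nonempty} := by
  classical
  have hlen : ∀ t ∈ T, ∃ n, ∀ x ∈ t, cyl x n ⊆ t := by
    intro t ht
    obtain ⟨y, n, rfl⟩ := hT t ht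
    refine ⟨n, fun x hx => ?_⟩
    rw [cyl_eq hx]
  choose! len hlen using hlen
  obtain ⟨f, hf1, hf2⟩ := sum_choice (k := k) (fun l n => Cardinal.mk (cnt n (P ∩ e l)))
    (fun l m n h => cnt_mono _ h) hth N
  let F : Set (ℕ → S) → ℕ := fun t => if h : ∃ l, e l = t then f h.choose else N
  have hF : ∀ l, F (e l) = f l := by
    intro l
    have h : ∃ l', e l' = e l := ⟨l, rfl⟩
    have h2 : F (e l) = f h.choose := dif_pos h
    rw [h2, he h.choose_spec]
  let g : Set (ℕ → S) → ℕ := fun t => max (len t) (max N (F t))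
  have hgt : ∀ t ∈ T, ∀ x ∈ t, cyl x (g t) ⊆ t := fun t ht x hx =>
    (cyl_anti x (le_max_left _ _)).trans (hlen t ht x hx)
  have huniq : ∀ t ∈ T, ∀ t' ∈ T, ∀ z, z ∈ t → z ∈ t' → t = t' := by
    intro t ht t' ht' z hz hz'
    by_contra hne
    exact Set.disjoint_left.mp (hd ht ht' hne) hz hz'
  refine ⟨{s | ∃ t ∈ T, ∃ x ∈ t, s = cyl x (g t)}, ?_, ?_, ?_, ?_⟩
  · rintro s ⟨t, ht, x, hx, rfl⟩
    refine ⟨⟨x, g t, rfl⟩, small_cyl ?_, t, ht, hgt t ht x hx⟩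
    exact (le_max_left _ _).trans (le_max_right _ _)
  · rintro s ⟨t, ht, x, hx, rfl⟩ s' ⟨t', ht', x', hx', rfl⟩ hne
    rw [Function.onFun, Set.disjoint_left]
    intro z hz hz'
    apply hne
    have : t = t' := huniq t ht t' ht' z (hgt t ht x hx hz) (hgt t' ht' x' hx' hz')
    subst this
    rw [← cyl_eq hz, ← cyl_eq hz']
  · ext z
    constructor
    · rintro ⟨s, ⟨t, ht, x, hx, rfl⟩, hz⟩
      exact ⟨t, ht, hgt t ht x hx hz⟩
    · rintro ⟨t, ht, hz⟩
      exact ⟨_, ⟨t, ht, z, hz, rfl⟩, self_mem_cyl z _⟩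
  · refine hf2.trans ?_
    rw [← Cardinal.mk_sigma]
    have hle : ∀ l, Cardinal.mk (cnt (f l) (P ∩ e l)) ≤ Cardinal.mk (cnt (g (e l)) (P ∩ e l)) := by
      intro l
      apply cnt_mono
      rw [← hF l]
      exact (le_max_right _ _).trans (le_max_right _ _)
    have hle2 : Cardinal.mk (Σ l, cnt (f l) (P ∩ e l)) ≤
        Cardinal.mk (Σ l, cnt (g (e l)) (P ∩ e l)) := by
      rw [Cardinal.mk_sigma, Cardinal.mk_sigma]
      exact Cardinal.sum_le_sum _ _ hle
    refine hle2.trans ?_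
    have hmem : ∀ p : (Σ l, cnt (g (e l)) (P ∩ e l)), p.2.1 ∈
        {t | t ∈ {s | ∃ t ∈ T, ∃ x ∈ t, s = cyl x (g t)} ∧ (t ∩ P).Nonempty} := by
      rintro ⟨l, t, x, ⟨hxP, hxe⟩, rfl⟩
      exact ⟨⟨e l, heT l, x, hxe, rfl⟩, x, self_mem_cyl x _, hxP⟩
    refine Cardinal.mk_le_of_injective (f := fun p => ⟨p.2.1, hmem p⟩) ?_
    rintro ⟨l, t, x, ⟨hxP, hxe⟩, rfl⟩ ⟨l', t', x', ⟨hxP', hxe'⟩, rfl⟩ h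
    have h1 : cyl x (g (e l)) = cyl x' (g (e l')) := congrArg Subtype.val h
    have h2 : l = l' := by
      apply he
      apply huniq _ (heT l) _ (heT l') x hxe
      apply hgt _ (heT l') x' hxe'
      rw [← h1]
      exact self_mem_cyl x _
    subst h2
    congr 1
    exact Subtype.ext h1

lemma mk_cyl_le {k : Cardinal.{u}} (hk : Cardinal.aleph0 ≤ k) (hS : Cardinal.mk S ≤ k) :
    Cardinal.mk {t : Set (ℕ → S) | IsCyl t} ≤ k := by
  have h1 : {t : Set (ℕ → S) | IsCyl t} ⊆ Set.range (fun l : List S =>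
      {y : ℕ → S | List.ofFn (fun i : Fin l.length => y i) = l}) := by
    rintro t ⟨x, n, rfl⟩
    refine ⟨List.ofFn (fun i : Fin n => x i), ?_⟩
    ext y
    simp only [mem_setOf_eq, cyl]
    rw [List.ext_get_iff]
    simp only [List.length_ofFn, List.get_eq_getElem, List.getElem_ofFn, true_and]
    constructor
    · intro h i hi
      exact h i hi hi
    · intro h i hi _
      exact h i hi
  refine (Cardinal.mk_le_mk_of_subset h1).trans (Cardinal.mk_range_le.trans ?_)
  exact (Cardinal.mk_list_le_max S).trans (max_le hk hS)

end Count
end AIIproof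

namespace AIIproof
section Barrier
variable {S : Type u} [TopologicalSpace S] [DiscreteTopology S]

lemma barrier_one {A : Set (ℕ → S)} {k : Cardinal.{u}} {I : Set (ℕ → S) → Prop}
    (hk : Cardinal.aleph0 ≤ k) (hI : IdealAx A k I)
    {M V : Set (ℕ → S)} (hM : Good A I M) (hV : IsClopen V) (hne : (V ∩ M).Nonempty) (N : ℕ) :
    ∃ T : Set (Set (ℕ → S)), (∀ t ∈ T, IsCyl t ∧ Small N t ∧ t ⊆ V) ∧
      T.PairwiseDisjoint id ∧ A ∩ V ⊆ ⋃₀ T ∧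
      k ≤ Cardinal.mk {t | t ∈ T ∧ (t ∩ M).Nonempty} := by
  classical
  obtain ⟨b, ⟨hbV, hbM⟩, hbA⟩ : ∃ b ∈ V ∩ M, b ∉ A := by
    by_contra hcon
    push Not at hcon
    apply hM.pos V hV.isOpen hne
    exact hI.mono _ _ (hI.gd (V ∩ M) (hV.isClosed.inter hM.closed).isGδ hcon) inter_subset_right
  let p : Set (ℕ → S) → Prop := fun W => b ∉ W ∧ W ⊆ V
  have hcov : ∀ x ∈ V, x ≠ b → ∃ t ∈ hit p, x ∈ t := by
    intro x hx hxb
    obtain ⟨n, hn⟩ := exists_cyl_subset (hV.isOpen.inter (isOpen_compl_singleton (x := b)))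
      (x := x) ⟨hx, hxb⟩
    obtain ⟨m, -, hm⟩ := exists_hit (p := p) (x := x) (n := n)
      ⟨fun h => (hn h).2 rfl, fun y hy => (hn hy).1⟩
    exact ⟨_, hm, self_mem_cyl x m⟩
  have hinf : {t | t ∈ hit p ∧ (t ∩ M).Nonempty}.Infinite := by
    intro hfin
    have hcl : IsClosed (⋃₀ {t | t ∈ hit p ∧ (t ∩ M).Nonempty}) := by
      rw [sUnion_eq_biUnion]
      exact Set.Finite.isClosed_biUnion hfin fun t ht => (hit_cyl ht.1).clopen.isClosed
    have hbU : b ∉ ⋃₀ {t | t ∈ hit p ∧ (t ∩ M).Nonempty} := by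
      rintro ⟨t, ht, hbt⟩
      exact (hit_p ht.1).1 hbt
    apply hM.pos (V ∩ (⋃₀ {t | t ∈ hit p ∧ (t ∩ M).Nonempty})ᶜ)
      (hV.isOpen.inter hcl.isOpen_compl) ⟨b, ⟨hbV, hbU⟩, hbM⟩
    refine hI.mono _ _ (hI.gd ∅ IsGδ.empty (empty_subset _)) ?_
    rintro x ⟨hxA, ⟨hxV, hxU⟩, hxM⟩
    exfalso
    obtain ⟨t, ht, hxt⟩ := hcov x hxV (fun h => hbA (h ▸ hxA))
    exact hxU ⟨t, ⟨ht, x, hxt, hxM⟩, hxt⟩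
  let e := Set.Infinite.natEmbedding _ hinf
  obtain ⟨R, hR1, hR2, hR3, hR4⟩ := refine_family (k := k) (A ∩ M) (hit p)
    (fun t ht => hit_cyl ht) (hit_disj p) (fun l => (e l).1)
    (fun a b h => e.injective (Subtype.ext h)) (fun l => (e l).2.1) (fun l => by
      apply thick_of_not_weightLT hk
      intro hw
      apply hM.pos (e l).1 (hit_cyl (e l).2.1).clopen.isOpen (e l).2.2
      refine hI.mono _ _ (hI.small _ hw) ?_
      rintro x ⟨h1, h2, h3⟩
      exact ⟨⟨h1, h3⟩, h2⟩) N
  refine ⟨R, ?_, hR2, ?_, ?_⟩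
  · intro t ht
    obtain ⟨h1, h2, s, hs, hts⟩ := hR1 t ht
    exact ⟨h1, h2, hts.trans (hit_p hs).2⟩
  · rintro x ⟨hxA, hxV⟩
    rw [hR3]
    obtain ⟨t, ht, hxt⟩ := hcov x hxV (fun h => hbA (h ▸ hxA))
    exact ⟨t, ht, hxt⟩
  · refine hR4.trans (Cardinal.mk_le_mk_of_subset ?_)
    rintro t ⟨ht, x, hx1, hx2⟩
    exact ⟨ht, x, hx1, hx2.2⟩

/-- validity of a state of the construction -/
structure Valid (A : Set (ℕ → S)) (I : Set (ℕ → S) → Prop) (C : ℕ → ℕ → Set (ℕ → S))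
    (n : ℕ) (V : Set (ℕ → S)) (Y : ℕ → Set (ℕ → S)) : Prop where
  cyl : IsCyl V
  zero : Y 0 = univ
  good : ∀ i ≤ n, Good A I (Y i)
  meets : (V ∩ Y n).Nonempty
  sub : ∀ i < n, Y (i + 1) ⊆ Y i
  nwd : ∀ i < n, Nwd (Y (i + 1)) (Y i)
  inC : ∀ i < n, Y (i + 1) ⊆ ⋃ m, C i m

lemma Valid.anti {A : Set (ℕ → S)} {I : Set (ℕ → S) → Prop} {C : ℕ → ℕ → Set (ℕ → S)}
    {n : ℕ} {V : Set (ℕ → S)} {Y : ℕ → Set (ℕ → S)} (h : Valid A I C n V Y) {i j : ℕ}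
    (hij : i ≤ j) (hj : j ≤ n) : Y j ⊆ Y i := by
  induction j, hij using Nat.le_induction with
  | base => exact subset_rfl
  | succ j hij ih => exact (h.sub j (by omega)).trans (ih (by omega))

lemma barrier_chain {A : Set (ℕ → S)} {k : Cardinal.{u}} {I : Set (ℕ → S) → Prop}
    {C : ℕ → ℕ → Set (ℕ → S)}
    (hk : Cardinal.aleph0 ≤ k) (hI : IdealAx A k I)
    {n : ℕ} {V : Set (ℕ → S)} {Y : ℕ → Set (ℕ → S)} (h : Valid A I C n V Y) (N : ℕ) :
    ∃ T : Set (Set (ℕ → S)), (∀ t ∈ T, IsCyl t ∧ Small N t ∧ t ⊆ V) ∧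
      T.PairwiseDisjoint id ∧ A ∩ V ⊆ ⋃₀ T ∧
      ∀ j ≤ n, k ≤ Cardinal.mk {t | t ∈ T ∧ (t ∩ Y j).Nonempty ∧ (j < n → t ∩ Y (j + 1) = ∅)} := by
  classical
  have hVm : ∀ j ≤ n, (V ∩ Y j).Nonempty := fun j hj =>
    h.meets.mono (inter_subset_inter_right _ (h.anti hj le_rfl))
  have hy : ∀ j, ∃ y m, j ≤ n → y ∈ V ∧ y ∈ Y j ∧ (j < n → ∀ z ∈ Y (j + 1), z ∉ cyl y m) := by
    intro j
    by_cases hj : j ≤ n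
    · by_cases hj' : j < n
      · obtain ⟨y, ⟨hyV, hyY⟩, hyZ⟩ := h.nwd j hj' V h.cyl.clopen.isOpen (hVm j hj)
        obtain ⟨m, hm⟩ := exists_cyl_subset (h.good (j + 1) (by omega)).closed.isOpen_compl hyZ
        exact ⟨y, m, fun _ => ⟨hyV, hyY, fun _ z hz hz' => hm hz' hz⟩⟩
      · obtain ⟨y, hyV, hyY⟩ := hVm j hj
        exact ⟨y, 0, fun _ => ⟨hyV, hyY, fun h => absurd h hj'⟩⟩
    · obtain ⟨y, -⟩ := h.meets
      exact ⟨y, 0, fun h => absurd h hj⟩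
  choose y m hy using hy
  obtain ⟨v, n0, hVeq⟩ := h.cyl
  set m0 : ℕ := max (max n0 N) ((Finset.range (n + 1)).sup m) with hm0
  have hm0n : n0 ≤ m0 := (le_max_left _ _).trans (le_max_left _ _)
  have hm0N : N ≤ m0 := (le_max_right _ _).trans (le_max_left _ _)
  have hm0j : ∀ j ≤ n, m j ≤ m0 := fun j hj =>
    (Finset.le_sup (f := m) (Finset.mem_range.mpr (by omega))).trans (le_max_right _ _)
  have hyZ : ∀ j, j < n → ∀ z ∈ Y (j + 1), z ∉ cyl (y j) m0 := fun j hj z hz hz' =>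
    (hy j hj.le).2.2 hj z hz (cyl_anti _ (hm0j j hj.le) hz')
  have hinj : ∀ j ≤ n, ∀ j' ≤ n, cyl (y j) m0 = cyl (y j') m0 → j = j' := by
    have aux : ∀ j ≤ n, ∀ j' ≤ n, j < j' → cyl (y j) m0 ≠ cyl (y j') m0 := by
      intro j hj j' hj' hlt heq
      apply hyZ j (by omega) (y j') (h.anti hlt hj' (hy j' hj').2.1)
      rw [heq]
      exact self_mem_cyl _ _
    intro j hj j' hj' heq
    rcases lt_trichotomy j j' with hl | hl | hl
    · exact absurd heq (aux j hj j' hj' hl)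
    · exact hl
    · exact absurd heq.symm (aux j' hj' j hj hl)
  have hR : ∀ x : ℕ → S, ∃ R : Set (Set (ℕ → S)), (∀ t ∈ R, IsCyl t ∧ Small N t ∧ t ⊆ cyl x m0) ∧
      R.PairwiseDisjoint id ∧ A ∩ cyl x m0 ⊆ ⋃₀ R ∧
      ∀ j ≤ n, cyl x m0 = cyl (y j) m0 → k ≤ Cardinal.mk {t | t ∈ R ∧ (t ∩ Y j).Nonempty} := by
    intro x
    by_cases hx : ∃ j ≤ n, cyl x m0 = cyl (y j) m0
    · obtain ⟨j, hj, hxj⟩ := hx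
      obtain ⟨R, h1, h2, h3, h4⟩ := barrier_one hk hI (h.good j hj) (cyl_clopen x m0)
        ⟨y j, by rw [hxj]; exact self_mem_cyl _ _, (hy j hj).2.1⟩ N
      refine ⟨R, h1, h2, h3, ?_⟩
      intro j' hj' hxj'
      rw [← hinj j hj j' hj' (hxj.symm.trans hxj')]
      exact h4
    · refine ⟨{cyl x m0}, ?_, ?_, ?_, ?_⟩
      · rintro t rfl
        exact ⟨⟨x, m0, rfl⟩, small_cyl hm0N, subset_rfl⟩
      · exact pairwiseDisjoint_singleton _ _
      · rw [sUnion_singleton]; exact inter_subset_right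
      · intro j hj hxj
        exact absurd ⟨j, hj, hxj⟩ hx
  -- make the choice depend only on the cylinder
  have hR' : ∀ s : Set (ℕ → S), ∃ R : Set (Set (ℕ → S)), (∃ x, s = cyl x m0) →
      (∀ t ∈ R, IsCyl t ∧ Small N t ∧ t ⊆ s) ∧
      R.PairwiseDisjoint id ∧ A ∩ s ⊆ ⋃₀ R ∧
      ∀ j ≤ n, s = cyl (y j) m0 → k ≤ Cardinal.mk {t | t ∈ R ∧ (t ∩ Y j).Nonempty} := by
    intro s
    by_cases hs : ∃ x, s = cyl x m0
    · obtain ⟨x, rfl⟩ := hs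
      obtain ⟨R, hR⟩ := hR x
      exact ⟨R, fun _ => hR⟩
    · exact ⟨∅, fun h => absurd h hs⟩
  choose R hR using hR'
  refine ⟨⋃ x ∈ V, R (cyl x m0), ?_, ?_, ?_, ?_⟩
  · intro t ht
    simp only [mem_iUnion] at ht
    obtain ⟨x, hxV, ht⟩ := ht
    obtain ⟨h1, h2, h3⟩ := (hR (cyl x m0) ⟨x, rfl⟩).1 t ht
    refine ⟨h1, h2, h3.trans ((cyl_anti x hm0n).trans ?_)⟩
    rw [hVeq] at hxV ⊢
    rw [cyl_eq hxV]
  · intro t ht t' ht' hne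
    simp only [mem_iUnion] at ht ht'
    obtain ⟨x, hxV, ht⟩ := ht
    obtain ⟨x', hxV', ht'⟩ := ht'
    by_cases hxx : cyl x m0 = cyl x' m0
    · rw [← hxx] at ht'
      exact (hR (cyl x m0) ⟨x, rfl⟩).2.1 ht ht' hne
    · rw [Function.onFun, Set.disjoint_left]
      intro z hz hz'
      apply hxx
      have h1 := (((hR (cyl x m0) ⟨x, rfl⟩).1 t ht).2.2 hz)
      have h2 := (((hR (cyl x' m0) ⟨x', rfl⟩).1 t' ht').2.2 hz')
      rw [← cyl_eq h1, ← cyl_eq h2]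
  · rintro x ⟨hxA, hxV⟩
    obtain ⟨t, ht, hxt⟩ := (hR (cyl x m0) ⟨x, rfl⟩).2.2.1 ⟨hxA, self_mem_cyl x m0⟩
    refine ⟨t, ?_, hxt⟩
    simp only [mem_iUnion]
    exact ⟨x, hxV, ht⟩
  · intro j hj
    refine ((hR (cyl (y j) m0) ⟨_, rfl⟩).2.2.2 j hj rfl).trans (Cardinal.mk_le_mk_of_subset ?_)
    rintro t ⟨ht, htY⟩
    refine ⟨?_, htY, ?_⟩
    · simp only [mem_iUnion]
      exact ⟨y j, (hy j hj).1, ht⟩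
    · intro hjn
      rw [Set.eq_empty_iff_forall_notMem]
      rintro z ⟨hz1, hz2⟩
      exact hyZ j hjn z hz2 (((hR (cyl (y j) m0) ⟨_, rfl⟩).1 t ht).2.2 hz1)

lemma fiber_equiv {α : Type u} {β : Type v} {κ : Type u} (J : α → β)
    (h : ∀ b, Cardinal.mk {a // J a = b} = Cardinal.mk κ) :
    ∃ e : α ≃ β × κ, ∀ a, (e a).1 = J a := by
  have : ∀ b, Nonempty ({a // J a = b} ≃ κ) := fun b => Cardinal.eq.mp (h b)
  let f : ∀ b, {a // J a = b} ≃ κ := fun b => (this b).some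
  refine ⟨(Equiv.sigmaFiberEquiv J).symm.trans ((Equiv.sigmaCongrRight f).trans
    (Equiv.sigmaEquivProd β κ)), ?_⟩
  intro a
  rfl

lemma extend_one {A : Set (ℕ → S)} {k : Cardinal.{u}} {I : Set (ℕ → S) → Prop}
    {C : ℕ → ℕ → Set (ℕ → S)} (hI : IdealAx A k I) (hC : Pres A C)
    {M K V : Set (ℕ → S)} (hM : Good A I M) (hK : IsClosed K) (hKM : Nwd K M) 
    (hV : IsClopen V) (hne : (V ∩ M).Nonempty) (i m : ℕ) :
    ∃ Y ⊆ M, Good A I Y ∧ Nwd Y M ∧ Y ⊆ (⋃ m, C i m) ∧ V ∩ M ∩ K ∩ C i m ⊆ Y ∧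
      (V ∩ Y).Nonempty := by
  obtain ⟨Y, h1, h2, h3, h4, h5⟩ := designate hI hC (hM.restrict hV hne) hK
    (hKM.restrict hV.isOpen) i m
  refine ⟨Y, h1.trans inter_subset_right, h2, ?_, h4, h5, ?_⟩
  · intro W hW hWne
    by_cases hWV : (W ∩ (V ∩ M)).Nonempty
    · obtain ⟨z, ⟨hz1, hz2⟩, hz3⟩ := h3 W hW hWV
      exact ⟨z, ⟨hz1, hz2.2⟩, hz3⟩
    · obtain ⟨z, hz1, hz2⟩ := hWne
      refine ⟨z, ⟨hz1, hz2⟩, fun hz => hWV ⟨z, hz1, h1 hz⟩⟩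
  · obtain ⟨z, hz⟩ := h2.ne
    exact ⟨z, (h1 hz).1, hz⟩

lemma extend_chain {A : Set (ℕ → S)} {k : Cardinal.{u}} {I : Set (ℕ → S) → Prop}
    {C : ℕ → ℕ → Set (ℕ → S)} (hI : IdealAx A k I) (hC : Pres A C)
    {KK : Set (ℕ → S) → ℕ → Set (ℕ → S)} (hKK : ∀ M, Good A I M → Wit A M (KK M))
    {j m : ℕ} {V : Set (ℕ → S)} {Y : ℕ → Set (ℕ → S)} (h : Valid A I C j V Y)
    (l : ℕ) (hjl : j ≤ l) :
    ∃ Y', Valid A I C l V Y' ∧ (∀ i ≤ j, Y' i = Y i) ∧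
      (j < l → V ∩ Y j ∩ KK (Y j) m ∩ C j m ⊆ Y' (j + 1)) := by
  induction l, hjl using Nat.le_induction with
  | base => exact ⟨Y, h, fun _ _ => rfl, fun h => absurd h (lt_irrefl _)⟩
  | succ l hjl ih =>
    obtain ⟨Y', hv, hag, hcap⟩ := ih
    have hw := hKK _ (hv.good l le_rfl)
    obtain ⟨Z, h1, h2, h3, h4, h5, h6⟩ := extend_one hI hC (hv.good l le_rfl) (hw.2.1 m)
      (hw.2.2.2 m) hv.cyl.clopen hv.meets l m
    have hu : ∀ i ≤ l, Function.update Y' (l + 1) Z i = Y' i := fun i hi =>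
      Function.update_of_ne (by omega) _ _
    have hu1 : Function.update Y' (l + 1) Z (l + 1) = Z := Function.update_self _ _ _
    refine ⟨Function.update Y' (l + 1) Z, ⟨hv.cyl, ?_, ?_, ?_, ?_, ?_, ?_⟩, ?_, ?_⟩
    · rw [hu 0 (by omega)]; exact hv.zero
    · intro i hi
      rcases Nat.lt_or_ge l i with h' | h'
      · obtain rfl : i = l + 1 := by omega
        rw [hu1]; exact h2
      · rw [hu i h']; exact hv.good i h'
    · rw [hu1]; exact h6
    · intro i hi
      rcases Nat.lt_or_ge i l with h' | h'
      · rw [hu i (by omega), hu (i + 1) (by omega)]; exact hv.sub i h'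
      · obtain rfl : i = l := by omega
        rw [hu1, hu i le_rfl]; exact h1
    · intro i hi
      rcases Nat.lt_or_ge i l with h' | h'
      · rw [hu i (by omega), hu (i + 1) (by omega)]; exact hv.nwd i h'
      · obtain rfl : i = l := by omega
        rw [hu1, hu i le_rfl]; exact h3
    · intro i hi
      rcases Nat.lt_or_ge i l with h' | h'
      · rw [hu (i + 1) (by omega)]; exact hv.inC i h'
      · obtain rfl : i = l := by omega
        rw [hu1]; exact h4
    · intro i hi
      rw [hu i (by omega)]; exact hag i hi
    · intro _
      rcases Nat.lt_or_ge j l with h' | h'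
      · rw [hu (j + 1) (by omega)]; exact hcap h'
      · obtain rfl : j = l := by omega
        rw [hu1, ← hag j le_rfl]; exact h5

lemma step {A : Set (ℕ → S)} {k : Cardinal.{u}} {I : Set (ℕ → S) → Prop}
    {C : ℕ → ℕ → Set (ℕ → S)} (hk : Cardinal.aleph0 ≤ k) (hS : Cardinal.mk S ≤ k)
    (hI : IdealAx A k I) (hC : Pres A C)
    {KK : Set (ℕ → S) → ℕ → Set (ℕ → S)} (hKK : ∀ M, Good A I M → Wit A M (KK M))
    {n : ℕ} {V : Set (ℕ → S)} {Y : ℕ → Set (ℕ → S)} (h : Valid A I C n V Y) :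
    ∃ (V' : Fin (n + 1) × DiscT k → Set (ℕ → S)) (Y' : Fin (n + 1) × DiscT k → ℕ → Set (ℕ → S)),
      (∀ c, Valid A I C (n + 1) (V' c) (Y' c) ∧ V' c ⊆ V ∧ Small (n + 1) (V' c) ∧
        (∀ i ≤ c.1.1, Y' c i = Y i) ∧ (c.1.1 < n → V' c ∩ Y (c.1.1 + 1) = ∅) ∧
        V' c ∩ Y c.1.1 ∩ KK (Y c.1.1) n ∩ C c.1.1 n ⊆ Y' c (c.1.1 + 1)) ∧
      (∀ c c', c ≠ c' → Disjoint (V' c) (V' c')) ∧ A ∩ V ⊆ ⋃ c, V' c := by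
  classical
  obtain ⟨T, hT1, hT2, hT3, hT4⟩ := barrier_chain hk hI h (n + 1)
  have hne : ∀ t ∈ T, ((t : Set (ℕ → S)) ∩ Y 0).Nonempty := by
    intro t ht
    obtain ⟨x, m, rfl⟩ := (hT1 t ht).1
    rw [h.zero]
    exact ⟨x, self_mem_cyl x m, trivial⟩
  let q : T → ℕ → Prop := fun t j => ((t.1 : Set (ℕ → S)) ∩ Y j).Nonempty
  let J : T → Fin (n + 1) := fun t => ⟨Nat.findGreatest (q t) n, by
    have := Nat.findGreatest_le (P := q t) n
    omega⟩
  have hJ1 : ∀ t : T, (t.1 ∩ Y (J t).1).Nonempty := fun t =>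
    Nat.findGreatest_spec (P := q t) (m := 0) (Nat.zero_le n) (hne t.1 t.2)
  have hJ2 : ∀ t : T, (J t).1 < n → t.1 ∩ Y ((J t).1 + 1) = ∅ := by
    intro t hlt
    by_contra hcon
    have hq : q t ((J t).1 + 1) := Set.nonempty_iff_ne_empty.mpr hcon
    exact Nat.findGreatest_is_greatest (P := q t) (Nat.lt_succ_self _) hlt hq
  have hfib : ∀ j, Cardinal.mk {t : T // J t = j} = Cardinal.mk (DiscT k) := by
    intro j
    have hDk : Cardinal.mk (DiscT k) = k := Cardinal.mk_out k
    rw [hDk]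
    apply le_antisymm
    · refine le_trans ?_ (mk_cyl_le hk hS)
      refine Cardinal.mk_le_of_injective (f := fun t => (⟨t.1.1, (hT1 t.1.1 t.1.2).1⟩ :
        {t : Set (ℕ → S) | IsCyl t})) ?_
      intro a b hab
      have h1 : a.1.1 = b.1.1 := congrArg (fun x => x.1) hab
      exact Subtype.ext (Subtype.ext h1)
    · refine (hT4 j.1 (by omega)).trans ?_
      refine Cardinal.mk_le_of_injective (f := fun t => (⟨⟨t.1, t.2.1⟩, ?_⟩ :
        {t : T // J t = j})) ?_
      · obtain ⟨t, ht, htj, htj'⟩ := t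
        apply Fin.ext
        show Nat.findGreatest (q ⟨t, ht⟩) n = j.1
        have hle : j.1 ≤ n := by omega
        apply le_antisymm
        · by_contra hlt
          push Not at hlt
          have hle2 := Nat.findGreatest_le (P := q ⟨t, ht⟩) n
          obtain ⟨z, hz1, hz2⟩ := hJ1 ⟨t, ht⟩
          have hz3 : z ∈ t ∩ Y (j.1 + 1) := ⟨hz1, h.anti hlt hle2 hz2⟩
          rw [htj' (by omega)] at hz3
          exact hz3
        · exact Nat.le_findGreatest hle htj
      · intro a b hab
        have := congrArg (fun x => x.1.1) hab
        exact Subtype.ext this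
  obtain ⟨e, he⟩ := fiber_equiv J hfib
  have hJe : ∀ c, J (e.symm c) = c.1 := by
    intro c
    rw [← he, Equiv.apply_symm_apply]
  have hY' : ∀ c, ∃ Y', Valid A I C (n + 1) (e.symm c).1 Y' ∧ (∀ i ≤ c.1.1, Y' i = Y i) ∧
      (e.symm c).1 ∩ Y c.1.1 ∩ KK (Y c.1.1) n ∩ C c.1.1 n ⊆ Y' (c.1.1 + 1) := by
    intro c
    have hc : c.1.1 ≤ n := by omega
    have hv : Valid A I C c.1.1 (e.symm c).1 Y := by
      refine ⟨(hT1 _ (e.symm c).2).1, h.zero, fun i hi => h.good i (by omega), ?_,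
        fun i hi => h.sub i (by omega), fun i hi => h.nwd i (by omega),
        fun i hi => h.inC i (by omega)⟩
      have := hJ1 (e.symm c)
      rwa [hJe c] at this
    obtain ⟨Y', h1, h2, h3⟩ := extend_chain hI hC hKK (m := n) hv (n + 1) (by omega)
    exact ⟨Y', h1, h2, h3 (by omega)⟩
  choose Y' hY' using hY'
  refine ⟨fun c => (e.symm c).1, Y', ?_, ?_, ?_⟩
  · intro c
    obtain ⟨h1, h2, h3⟩ := hY' c
    refine ⟨h1, (hT1 _ (e.symm c).2).2.2, (hT1 _ (e.symm c).2).2.1, h2, ?_, h3⟩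
    have := hJ2 (e.symm c)
    rwa [hJe c] at this
  · intro c c' hcc
    exact hT2 (e.symm c).2 (e.symm c').2 fun h => hcc (e.symm.injective (Subtype.ext h))
  · intro x hx
    obtain ⟨t, ht, hxt⟩ := hT3 hx
    rw [mem_iUnion]
    exact ⟨e ⟨t, ht⟩, by simpa using hxt⟩

end Barrier
end AIIproof

namespace AIIproof

/-- The model space. -/
abbrev KT (k : Cardinal.{u}) : Type u :=
  {x : (n : ℕ) → Fin (n + 1) × DiscT k // ∀ i, ∀ᶠ n in atTop, i < (x n).1.1}

lemma continuous_of_locconst {X Y : Type*} [TopologicalSpace X] [TopologicalSpace Y]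
    (f : X → Y) (h : ∀ x, ∀ᶠ y in 𝓝 x, f y = f x) : Continuous f := by
  rw [continuous_iff_continuousAt]
  intro x
  exact (continuousAt_const (y := f x)).congr ((h x).mono fun y hy => hy.symm)

section Tree
variable {S : Type u} [TopologicalSpace S] [DiscreteTopology S]

/-- states -/
abbrev St (A : Set (ℕ → S)) (I : Set (ℕ → S) → Prop) (C : ℕ → ℕ → Set (ℕ → S)) (n : ℕ) : Type u :=
  {p : Set (ℕ → S) × (ℕ → Set (ℕ → S)) // Valid A I C n p.1 p.2}

/-- the state reached along a branch -/
def branch {σ : ℕ → Type u} {Λ : ℕ → Type u} (s0 : σ 0) (next : ∀ n, σ n → Λ n → σ (n + 1))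
    (x : ∀ n, Λ n) : ∀ n, σ n
  | 0 => s0
  | n + 1 => next n (branch s0 next x n) (x n)

lemma branch_congr {σ : ℕ → Type u} {Λ : ℕ → Type u} (s0 : σ 0)
    (next : ∀ n, σ n → Λ n → σ (n + 1)) (x y : ∀ n, Λ n) (n : ℕ) (h : ∀ i < n, x i = y i) :
    branch s0 next x n = branch s0 next y n := by
  induction n with
  | zero => rfl
  | succ n ih =>
    show next n _ _ = next n _ _
    rw [ih fun i hi => h i (by omega), h n (by omega)]

/-- the state reached by always following a strategy -/
def follow {σ : ℕ → Type u} {Λ : ℕ → Type u} (s0 : σ 0) (next : ∀ n, σ n → Λ n → σ (n + 1))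
    (lab : ∀ n, σ n → Λ n) : ∀ n, σ n
  | 0 => s0
  | n + 1 => next n (follow s0 next lab n) (lab n (follow s0 next lab n))

lemma branch_follow {σ : ℕ → Type u} {Λ : ℕ → Type u} (s0 : σ 0)
    (next : ∀ n, σ n → Λ n → σ (n + 1)) (lab : ∀ n, σ n → Λ n) (n : ℕ) :
    branch s0 next (fun n => lab n (follow s0 next lab n)) n = follow s0 next lab n := by
  induction n with
  | zero => rfl
  | succ n ih =>
    show next n _ _ = next n _ _
    rw [ih]

theorem tree_homeo {A : Set (ℕ → S)} {k : Cardinal.{u}} {I : Set (ℕ → S) → Prop}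
    {C : ℕ → ℕ → Set (ℕ → S)} (hk : Cardinal.aleph0 ≤ k) (hS : Cardinal.mk S ≤ k)
    (hI : IdealAx A k I) (hC : Pres A C) (hA : Good A I univ) : Nonempty (↥A ≃ₜ KT k) := by
  classical
  have hw : ∀ M, ∃ K, Good A I M → Wit A M K := by
    intro M
    by_cases h : Good A I M
    · obtain ⟨K, hK⟩ := h.wit
      exact ⟨K, fun _ => hK⟩
    · exact ⟨fun _ => ∅, fun h' => absurd h' h⟩
  choose KK hKK using hw
  obtain ⟨x0, -⟩ := hA.ne
  haveI : Nonempty (DiscT k) := by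
    rw [← Cardinal.mk_ne_zero_iff]
    have : Cardinal.mk (DiscT k) = k := Cardinal.mk_out k
    rw [this]
    exact (Cardinal.aleph0_pos.trans_le hk).ne'
  let Λ : ℕ → Type u := fun n => Fin (n + 1) × DiscT k
  have hstep : ∀ n (s : St A I C n), ∃ nx : Λ n → St A I C (n + 1),
      (∀ c, (nx c).1.1 ⊆ s.1.1 ∧ Small (n + 1) (nx c).1.1 ∧
        (∀ i ≤ c.1.1, (nx c).1.2 i = s.1.2 i) ∧ (c.1.1 < n → (nx c).1.1 ∩ s.1.2 (c.1.1 + 1) = ∅) ∧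
        (nx c).1.1 ∩ s.1.2 c.1.1 ∩ KK (s.1.2 c.1.1) n ∩ C c.1.1 n ⊆ (nx c).1.2 (c.1.1 + 1)) ∧
      (∀ c c', c ≠ c' → Disjoint (nx c).1.1 (nx c').1.1) ∧ A ∩ s.1.1 ⊆ ⋃ c, (nx c).1.1 := by
    intro n s
    obtain ⟨V', Y', h1, h2, h3⟩ := step hk hS hI hC hKK s.2
    exact ⟨fun c => ⟨(V' c, Y' c), (h1 c).1⟩, fun c => (h1 c).2, h2, h3⟩
  choose next hnext hdisj hcov using hstep
  let s0 : St A I C 0 := ⟨(univ, fun _ => univ), ⟨x0, 0, by ext y; simp [cyl]⟩, rfl,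
    fun _ _ => hA, ⟨x0, trivial, trivial⟩, fun i hi => by omega, fun i hi => by omega,
    fun i hi => by omega⟩
  let st : (∀ n, Λ n) → ∀ n, St A I C n := fun x => branch (Λ := Λ) s0 next x
  have hst : ∀ x n, st x (n + 1) = next n (st x n) (x n) := fun x n => rfl
  have hVa : ∀ x n, (st x (n + 1)).1.1 ⊆ (st x n).1.1 := fun x n => (hnext n (st x n) (x n)).1
  have hVanti : ∀ x, Antitone fun n => (st x n).1.1 := fun x => antitone_nat_of_succ_le (hVa x)
  have hsm : ∀ x n, Small n (st x n).1.1 := by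
    intro x n
    cases n with
    | zero => intro _ _ _ _ i hi; omega
    | succ n => exact (hnext n (st x n) (x n)).2.1
  have hcongr : ∀ x y n, (∀ i < n, x i = y i) → st x n = st y n := fun x y n h =>
    branch_congr (Λ := Λ) s0 next x y n h
  have hlabel : ∀ x y n z, z ∈ (st x n).1.1 → z ∈ (st y n).1.1 → ∀ i < n, x i = y i := by
    intro x y n z
    induction n with
    | zero => intro _ _ i hi; omega
    | succ n ih =>
      intro hzx hzy i hi
      have ih' := ih (hVa x n hzx) (hVa y n hzy)
      rcases Nat.lt_or_ge i n with h | h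
      · exact ih' i h
      · obtain rfl : i = n := by omega
        by_contra hne
        rw [hst] at hzx hzy
        rw [hcongr y x i fun a b => (ih' a b).symm] at hzy
        exact Set.disjoint_left.mp (hdisj i (st x i) _ _ hne) hzx hzy
  have hlim : ∀ x z, (∀ n, z ∈ (st x n).1.1) → ∀ j n0, (∀ n ≥ n0, j ≤ (x n).1.1) →
      ∀ n ≥ n0, (st x n).1.2 j = (st x n0).1.2 j ∧ z ∈ (st x n0).1.2 j := by
    intro x z hz j n0 hj
    have hconst : ∀ n ≥ n0, (st x n).1.2 j = (st x n0).1.2 j := by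
      intro n hn
      induction n, hn using Nat.le_induction with
      | base => rfl
      | succ n hn ih =>
        rw [← ih, hst]
        exact (hnext n (st x n) (x n)).2.2.1 j (hj n hn)
    have hmem : z ∈ (st x n0).1.2 j := by
      have hjn : ∀ n ≥ n0, j ≤ n := fun n hn => (hj n hn).trans (by have := (x n).1.2; omega)
      have hcl := ((st x n0).2.good j (hjn n0 le_rfl)).closed
      by_contra hcon
      obtain ⟨m, hm⟩ := exists_cyl_subset hcl.isOpen_compl hcon
      set n := max n0 m with hn
      obtain ⟨w, hw1, hw2⟩ := (st x n).2.meets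
      have hw3 := (st x n).2.anti (hjn n (le_max_left _ _)) le_rfl hw2
      rw [hconst n (le_max_left _ _)] at hw3
      refine hm ?_ hw3
      intro i hi
      exact hsm x n w hw1 z (hz n) i (lt_of_lt_of_le hi (le_max_right _ _))
    exact fun n hn => ⟨hconst n hn, hmem⟩
  -- labels of points of A
  have hF : ∀ z ∈ A, ∃ x : KT k, ∀ n, z ∈ (st x.1 n).1.1 := by
    intro z hzA
    have hl : ∀ n (s : St A I C n), ∃ c : Λ n, z ∈ s.1.1 → z ∈ (next n s c).1.1 := by
      intro n s
      by_cases hz : z ∈ s.1.1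
      · obtain ⟨c, hc⟩ := mem_iUnion.mp (hcov n s ⟨hzA, hz⟩)
        exact ⟨c, fun _ => hc⟩
      · exact ⟨(0, Classical.arbitrary _), fun h => absurd h hz⟩
    choose lab hlab using hl
    set x : ∀ n, Λ n := fun n => lab n (follow (Λ := Λ) s0 next lab n) with hx
    have hbf : ∀ n, st x n = follow (Λ := Λ) s0 next lab n := fun n =>
      branch_follow (Λ := Λ) s0 next lab n
    have hz : ∀ n, z ∈ (st x n).1.1 := by
      intro n
      induction n with
      | zero => trivial
      | succ n ih =>
        rw [hst]
        have : x n = lab n (st x n) := by rw [hbf n]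
        rw [this]
        exact hlab n _ ih
    refine ⟨⟨x, ?_⟩, hz⟩
    by_contra hcon
    have hcon0 := not_forall.mp hcon
    have hex : ∃ j, ¬ ∀ᶠ n in atTop, j < (x n).1.1 := hcon0
    set j := Nat.find hex with hj
    have hj1 : ¬ ∀ᶠ n in atTop, j < (x n).1.1 := Nat.find_spec hex
    have hj2 : ∀ᶠ n in atTop, j ≤ (x n).1.1 := by
      rcases Nat.eq_zero_or_pos j with h0 | h0
      · exact Eventually.of_forall fun n => by omega
      · have := Nat.find_min hex (m := j - 1) (by omega)
        rw [not_not] at this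
        filter_upwards [this] with n hn
        omega
    obtain ⟨n0, hn0⟩ := eventually_atTop.mp hj2
    have hfr : ∀ m, ∃ n ≥ m, (x n).1.1 = j := by
      intro m
      by_contra hcon2
      push Not at hcon2
      apply hj1
      filter_upwards [eventually_ge_atTop m, hj2] with n h1 h2
      have := hcon2 n h1
      omega
    have hl := hlim x z hz j n0 hn0
    set Yj := (st x n0).1.2 j with hYj
    have hjn0 : j ≤ n0 := (hn0 n0 le_rfl).trans (by have := (x n0).1.2; omega)
    have hg : Good A I Yj := (st x n0).2.good j hjn0
    have hzY : z ∈ Yj := (hl n0 le_rfl).2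
    obtain ⟨hw1, hw2, hw3, hw4⟩ := hKK Yj hg
    obtain ⟨m1, hm1⟩ := mem_iUnion.mp (hw3 ⟨hzA, hzY⟩)
    have hzA' := hzA
    rw [hC.eq] at hzA'
    obtain ⟨m2, hm2⟩ := mem_iUnion.mp (mem_iInter.mp hzA' j)
    obtain ⟨n, hn, hxn⟩ := hfr (max (max n0 m1) (max m2 (j + 1)))
    have hn1 : n0 ≤ n := ((le_max_left _ _).trans (le_max_left _ _)).trans hn
    have hn2 : m1 ≤ n := ((le_max_right _ _).trans (le_max_left _ _)).trans hn
    have hn3 : m2 ≤ n := ((le_max_left _ _).trans (le_max_right _ _)).trans hn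
    have hn4 : j + 1 ≤ n := ((le_max_right _ _).trans (le_max_right _ _)).trans hn
    have hcap : z ∈ (st x (n + 1)).1.2 (j + 1) := by
      have h5 := (hnext n (st x n) (x n)).2.2.2.2
      rw [hxn, ← hst] at h5
      apply h5
      rw [(hl n hn1).1]
      exact ⟨⟨⟨hz (n + 1), hzY⟩, hw1 hn2 hm1⟩, hC.mono j hn3 hm2⟩
    have hkill : ∀ m ≥ n + 1, (x m).1.1 = j → z ∉ (st x m).1.2 (j + 1) := by
      intro m hm hxm hzm
      have h4 := (hnext m (st x m) (x m)).2.2.2.1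
      rw [hxm, ← hst] at h4
      have h6 : z ∈ (st x (m + 1)).1.1 ∩ (st x m).1.2 (j + 1) := ⟨hz (m + 1), hzm⟩
      rw [h4 (by omega)] at h6
      exact h6
    have hall : ∀ m ≥ n + 1, z ∈ (st x m).1.2 (j + 1) := by
      intro m hm
      induction m, hm using Nat.le_induction with
      | base => exact hcap
      | succ m hm ih =>
        have h1 : (x m).1.1 ≠ j := fun h => hkill m hm h ih
        have h2 := hn0 m (by omega)
        rw [hst, (hnext m (st x m) (x m)).2.2.1 (j + 1) (by omega)]
        exact ih
    obtain ⟨m, hm, hxm⟩ := hfr (n + 1)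
    exact hkill m hm hxm (hall m hm)
  have hG : ∀ x : KT k, ∃ z ∈ A, ∀ n, z ∈ (st x.1 n).1.1 := by
    rintro ⟨x, hx⟩
    have hne : ∀ n, (st x n).1.1.Nonempty := fun n => (st x n).2.meets.mono inter_subset_left
    choose w hw using hne
    let z : ℕ → S := fun i => w (i + 1) i
    have hz : ∀ n, z ∈ (st x n).1.1 := by
      intro n
      by_contra hcon
      obtain ⟨m, hm⟩ := exists_cyl_subset (st x n).2.cyl.clopen.isClosed.isOpen_compl hcon
      have h1 : w (max n m) ∈ cyl z m := by
        intro i hi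
        have hle : i + 1 ≤ max n m := by have := le_max_right n m; omega
        exact hsm x (i + 1) _ (hVanti x hle (hw _)) _ (hw (i + 1)) i (Nat.lt_succ_self i)
      exact hm h1 (hVanti x (le_max_left n m) (hw _))
    refine ⟨z, ?_, hz⟩
    rw [hC.eq, mem_iInter]
    intro i
    obtain ⟨n0, hn0⟩ := eventually_atTop.mp (hx i)
    have hle : i < n0 := lt_of_lt_of_le (hn0 n0 le_rfl) (by have := (x n0).1.2; omega)
    exact (st x n0).2.inC i hle (hlim x z hz (i + 1) n0 hn0 n0 le_rfl).2
  have huniq : ∀ x z z', (∀ n, z ∈ (st x n).1.1) → (∀ n, z' ∈ (st x n).1.1) → z = z' := by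
    intro x z z' hz hz'
    funext i
    exact hsm x (i + 1) z (hz _) z' (hz' _) i (Nat.lt_succ_self i)
  choose F hF using hF
  choose G hGA hG using hG
  refine ⟨⟨⟨fun z => F z.1 z.2, fun x => ⟨G x, hGA x⟩, ?_, ?_⟩, ?_, ?_⟩⟩
  · rintro ⟨z, hz⟩
    exact Subtype.ext (huniq _ _ _ (hG _) (hF z hz))
  · intro x
    apply Subtype.ext
    funext i
    exact hlabel _ _ (i + 1) (G x) (hF (G x) (hGA x) _) (hG x _) i (Nat.lt_succ_self i)
  · apply Continuous.subtype_mk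
    apply continuous_pi
    intro i
    apply continuous_of_locconst
    rintro ⟨z, hz⟩
    have hop : IsOpen (st (F z hz).1 (i + 1)).1.1 := (st (F z hz).1 (i + 1)).2.cyl.clopen.isOpen
    have := (hop.preimage (continuous_subtype_val (p := (· ∈ A)))).mem_nhds
      (x := ⟨z, hz⟩) (hF z hz (i + 1))
    filter_upwards [this]
    rintro ⟨y, hy⟩ hyV
    exact hlabel _ _ (i + 1) y (hF y hy _) hyV i (Nat.lt_succ_self i)
  · apply Continuous.subtype_mk
    apply continuous_pi
    intro i
    apply continuous_of_locconst
    intro x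
    have hop : ∀ᶠ y in 𝓝 x, ∀ l ∈ Finset.range (i + 1), y.1 l = x.1 l := by
      rw [Filter.eventually_all_finset]
      intro l _
      have hc : Continuous fun y : KT k => y.1 l := (continuous_apply l).comp continuous_subtype_val
      exact hc.continuousAt.eventually (p := fun y => y = x.1 l)
        ((isOpen_discrete {x.1 l}).mem_nhds rfl)
    filter_upwards [hop] with y hy
    have h1 := hG y (i + 1)
    rw [hcongr y.1 x.1 (i + 1) fun l hl => hy l (Finset.mem_range.mpr hl)] at h1
    exact hsm x.1 (i + 1) _ h1 _ (hG x _) i (Nat.lt_succ_self i)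

end Tree
end AIIproof

namespace AIIproof
section Model
variable {k : Cardinal.{u}}

lemma mk_DiscT (k : Cardinal.{u}) : Cardinal.mk (DiscT k) = k := Cardinal.mk_out k

lemma mk_QBase (hk : Cardinal.aleph0 ≤ k) : Cardinal.mk (QBase k) = k := by
  show Cardinal.mk (DiscT k ⊕ PUnit.{u + 1}) = k
  rw [Cardinal.mk_sum, mk_DiscT]
  simp only [Cardinal.lift_id, Cardinal.mk_punit, Cardinal.lift_one]
  exact Cardinal.add_one_eq hk

/-- the base point -/
def pt (k : Cardinal.{u}) : QBase k := Sum.inr PUnit.unit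

/-- the other points -/
def inQ (c : DiscT k) : QBase k := Sum.inl c

lemma inQ_ne (c : DiscT k) : inQ c ≠ pt k := Sum.inl_ne_inr

lemma inQ_inj {a b : DiscT k} (h : inQ a = inQ b) : a = b := Sum.inl_injective h

lemma Qk_cont_val : Continuous (fun x : Qk k => x.1) := continuous_subtype_val

lemma Qk_cont_mk {X : Type*} [TopologicalSpace X] {f : X → ℕ → QBase k} (hf : Continuous f)
    (h : ∀ x, ∀ᶠ n in Filter.atTop, f x n = Sum.inr PUnit.unit) :
    Continuous (fun x => (⟨f x, h x⟩ : Qk k)) := Continuous.subtype_mk hf h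

open Classical in
/-- the first nontrivial row -/
noncomputable def firstRow {n : ℕ} (f : Fin (n + 1) → QBase k) : Fin (n + 1) :=
  ⟨Nat.find (p := fun m => m = n ∨ ∃ h : m < n + 1, f ⟨m, h⟩ ≠ pt k) ⟨n, Or.inl rfl⟩, by
    have := Nat.find_min' (p := fun m => m = n ∨ ∃ h : m < n + 1, f ⟨m, h⟩ ≠ pt k)
      ⟨n, Or.inl rfl⟩ (m := n) (Or.inl rfl)
    omega⟩

lemma firstRow_lt {n : ℕ} (f : Fin (n + 1) → QBase k) (i : Fin (n + 1)) (h : i < firstRow f) :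
    f i = pt k := by
  classical
  have := Nat.find_min (p := fun m => m = n ∨ ∃ h : m < n + 1, f ⟨m, h⟩ ≠ pt k)
    ⟨n, Or.inl rfl⟩ (m := i.1) h
  by_contra hcon
  exact this (Or.inr ⟨i.2, hcon⟩)

lemma lt_firstRow {n : ℕ} (f : Fin (n + 1) → QBase k) (i : ℕ) (hi : i < n)
    (h : ∀ j : Fin (n + 1), j.1 ≤ i → f j = pt k) : i < (firstRow f).1 := by
  classical
  have := Nat.find_spec (p := fun m => m = n ∨ ∃ h : m < n + 1, f ⟨m, h⟩ ≠ pt k)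
    ⟨n, Or.inl rfl⟩
  by_contra hcon
  push Not at hcon
  rcases this with h1 | ⟨h1, h2⟩
  · have : (firstRow f).1 = n := h1
    omega
  · exact h2 (h _ hcon)

lemma firstRow_le {n : ℕ} (f : Fin (n + 1) → QBase k) (j : Fin (n + 1))
    (h : f j ≠ pt k) : firstRow f ≤ j := by
  by_contra hcon
  push Not at hcon
  exact h (firstRow_lt f j hcon)

lemma mk_fiber (hk : Cardinal.aleph0 ≤ k) {n : ℕ} (j : Fin (n + 1)) :
    Cardinal.mk {f : Fin (n + 1) → QBase k // firstRow f = j} = Cardinal.mk (DiscT k) := by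
  classical
  apply le_antisymm
  · refine (Cardinal.mk_subtype_le _).trans ?_
    rw [mk_DiscT]
    have : Cardinal.mk (Fin (n + 1) → QBase k) = Cardinal.mk (QBase k) ^ (n + 1) := by
      simp only [Cardinal.mk_pi, Cardinal.prod_const, Cardinal.mk_fin, Cardinal.lift_natCast,
        Cardinal.lift_uzero, Cardinal.power_natCast]
    rw [this, mk_QBase hk]
    exact Cardinal.power_nat_le hk
  · refine Cardinal.mk_le_of_injective (f := fun c => (⟨Function.update (fun _ => pt k) j
      (inQ c), ?_⟩ : {f : Fin (n + 1) → QBase k // firstRow f = j})) ?_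
    · set f : Fin (n + 1) → QBase k := Function.update (fun _ => pt k) j (inQ c) with hf
      have h1 : f j = inQ c := Function.update_self _ _ _
      have h2 : ∀ i, i ≠ j → f i = pt k := fun i hi => Function.update_of_ne hi _ _
      apply le_antisymm
      · apply firstRow_le
        rw [h1]
        exact inQ_ne c
      · rcases Nat.eq_zero_or_pos j.1 with h0 | h0
        · rw [Fin.le_def]; omega
        · have := lt_firstRow f (j.1 - 1) (by omega) (fun i hi => h2 i (by
            intro h; rw [h] at hi; omega))
          rw [Fin.le_def]; omega
    · intro a b hab
      have := congrFun (congrArg Subtype.val hab) j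
      change Function.update (fun _ => pt k) j (inQ a) j =
        Function.update (fun _ => pt k) j (inQ b) j at this
      rw [Function.update_self, Function.update_self] at this
      exact inQ_inj this

theorem model_homeo (hk : Cardinal.aleph0 ≤ k) : Nonempty (QkOmega k ≃ₜ KT k) := by
  classical
  have he : ∀ n : ℕ, ∃ e : (Fin (n + 1) → QBase k) ≃ Fin (n + 1) × DiscT k,
      ∀ f, (e f).1 = firstRow f := fun n => fiber_equiv firstRow (mk_fiber hk)
  choose e he using he
  have hev : ∀ x : ℕ → Qk k, ∀ i, ∀ᶠ n in atTop,
      i < (e n (fun l => (x l.1).1 (n - l.1))).1.1 := by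
    intro x i
    have h1 : ∀ l ∈ Finset.range (i + 1), ∀ᶠ n in atTop, (x l).1 (n - l) = pt k := by
      intro l _
      exact (tendsto_sub_atTop_nat l).eventually (x l).2
    have h2 := (Filter.eventually_all_finset (Finset.range (i + 1))).mpr h1
    filter_upwards [h2, eventually_gt_atTop i] with n hn hi
    rw [he]
    apply lt_firstRow _ _ hi
    intro j hj
    exact hn j.1 (Finset.mem_range.mpr (by omega))
  have hback : ∀ y : KT k, ∀ i : ℕ, ∀ᶠ t in atTop,
      ((e (i + t)).symm (y.1 (i + t)) ⟨i, by omega⟩) = Sum.inr PUnit.unit := by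
    intro y i
    obtain ⟨N, hN⟩ := eventually_atTop.mp (y.2 i)
    filter_upwards [eventually_ge_atTop N] with t ht
    have h1 := hN (i + t) (by omega)
    apply firstRow_lt
    rw [← he, Equiv.apply_symm_apply, Fin.lt_def]
    exact h1
  have : Nonempty ((ℕ → Qk k) ≃ₜ KT k) := by
    refine ⟨⟨⟨fun x => ⟨fun n => e n (fun l => (x l.1).1 (n - l.1)), hev x⟩,
      fun y i => ⟨fun t => (e (i + t)).symm (y.1 (i + t)) ⟨i, by omega⟩, hback y i⟩,
      ?_, ?_⟩, ?_, ?_⟩⟩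
    · intro x
      funext i
      apply Subtype.ext
      funext t
      simp
    · intro y
      apply Subtype.ext
      funext n
      show e n (fun l => (e (l.1 + (n - l.1))).symm (y.1 (l.1 + (n - l.1))) ⟨l.1, _⟩) = y.1 n
      rw [← Equiv.eq_symm_apply]
      funext l
      have hl : l.1 + (n - l.1) = n := by omega
      have gen : ∀ m (hm : m = n) (hlt : l.1 < m + 1),
          (e m).symm (y.1 m) ⟨l.1, hlt⟩ = (e n).symm (y.1 n) l := by
        intro m hm hlt
        subst hm
        rfl
      exact gen _ hl _
    · apply Continuous.subtype_mk
      apply continuous_pi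
      intro n
      apply (continuous_of_discreteTopology (f := e n)).comp
      apply continuous_pi
      intro l
      exact (continuous_apply (n - l.1)).comp (Qk_cont_val.comp (continuous_apply l.1))
    · apply continuous_pi
      intro i
      apply Qk_cont_mk
      apply continuous_pi
      intro t
      exact (continuous_apply (⟨i, by omega⟩ : Fin (i + t + 1))).comp
        ((continuous_of_discreteTopology (f := (e (i + t)).symm)).comp
          ((continuous_apply (i + t)).comp continuous_subtype_val))
  exact this

end Model
end AIIproof

namespace AIIproof
section Weight

lemma weightLT_of_inducing {X Y : Type u} [TopologicalSpace X] [TopologicalSpace Y]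
    {k : Cardinal.{u}} (h : WeightLT Y k) {f : X → Y} (hf : IsInducing f) : WeightLT X k := by
  obtain ⟨B, hB, hBk⟩ := h
  exact ⟨_, hB.isInducing hf, Cardinal.mk_image_le.trans_lt hBk⟩

lemma inducing_incl {Z : Type*} [TopologicalSpace Z] {s t : Set Z} (h : s ⊆ t) :
    IsInducing (Set.inclusion h) :=
  IsInducing.of_comp (continuous_inclusion h) continuous_subtype_val
    (by exact IsInducing.subtypeVal)

lemma weightLT_subset {Z : Type u} [TopologicalSpace Z] {k : Cardinal.{u}} {s t : Set Z}
    (h : WeightLT ↥t k) (hst : s ⊆ t) : WeightLT ↥s k :=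
  weightLT_of_inducing h (inducing_incl hst)

lemma locallyWeightLT_iff {Z : Type u} [TopologicalSpace Z] {k : Cardinal.{u}} {s : Set Z} :
    LocallyWeightLT ↥s k ↔ ∀ x ∈ s, ∃ W, IsOpen W ∧ x ∈ W ∧ WeightLT ↥(W ∩ s) k := by
  constructor
  · intro h x hx
    obtain ⟨t, ht, hw⟩ := h ⟨x, hx⟩
    rw [mem_nhds_iff] at ht
    obtain ⟨O, hOt, hO, hxO⟩ := ht
    obtain ⟨W, hW, rfl⟩ := isOpen_induced_iff.mp hO
    refine ⟨W, hW, hxO, ?_⟩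
    let f : ↥(W ∩ s) → ↥t := fun y => ⟨⟨y.1, y.2.2⟩, hOt y.2.1⟩
    have hfc : Continuous f := (continuous_subtype_val.subtype_mk _).subtype_mk _
    refine weightLT_of_inducing hw (f := f) (IsInducing.of_comp hfc
      (continuous_subtype_val.comp continuous_subtype_val :
        Continuous fun y : ↥t => (y.1.1 : Z)) ?_)
    exact IsInducing.subtypeVal
  · rintro h ⟨x, hx⟩
    obtain ⟨W, hW, hxW, hw⟩ := h x hx
    refine ⟨Subtype.val ⁻¹' W, (hW.preimage continuous_subtype_val).mem_nhds hxW, ?_⟩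
    let f : ↥(Subtype.val ⁻¹' W : Set ↥s) → ↥(W ∩ s) := fun y => ⟨y.1.1, y.2, y.1.2⟩
    have hfc : Continuous f := (continuous_subtype_val.comp continuous_subtype_val).subtype_mk _
    refine weightLT_of_inducing hw (f := f) (IsInducing.of_comp hfc continuous_subtype_val ?_)
    have h3 : IsInducing ((Subtype.val : ↥s → Z) ∘
        (Subtype.val : ↥(Subtype.val ⁻¹' W : Set ↥s) → ↥s)) :=
      IsInducing.subtypeVal.comp IsInducing.subtypeVal
    exact h3

lemma locallyWeightLT_preimage {Z Y : Type u} [TopologicalSpace Z] [TopologicalSpace Y]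
    {k : Cardinal.{u}} {s : Set Z} (h : LocallyWeightLT ↥s k) {f : Y → Z} (hf : IsInducing f) :
    LocallyWeightLT ↥(f ⁻¹' s) k := by
  rw [locallyWeightLT_iff] at h ⊢
  intro x hx
  obtain ⟨W, hW, hxW, hw⟩ := h (f x) hx
  refine ⟨f ⁻¹' W, hW.preimage hf.continuous, hxW, ?_⟩
  let g : ↥(f ⁻¹' W ∩ f ⁻¹' s) → ↥(W ∩ s) := fun y => ⟨f y.1, y.2⟩
  have hgc : Continuous g := (hf.continuous.comp continuous_subtype_val).subtype_mk _
  refine weightLT_of_inducing hw (f := g) (IsInducing.of_comp hgc continuous_subtype_val ?_)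
  exact hf.comp IsInducing.subtypeVal

lemma weightLT_locally {Z : Type u} [TopologicalSpace Z] {k : Cardinal.{u}} {s : Set Z}
    (h : WeightLT ↥s k) : LocallyWeightLT ↥s k := by
  rw [locallyWeightLT_iff]
  intro x _
  exact ⟨univ, isOpen_univ, trivial, weightLT_subset h inter_subset_right⟩

lemma fsd_of_embedding {U F : Type u} [TopologicalSpace U] [TopologicalSpace F]
    {k : Cardinal.{u}} (hF : AbsFsigmaDelta F) {ψ : U → F} (hψ : IsEmbedding ψ)
    (hL : SigmaLW ↥((range ψ)ᶜ) k) : FsdMinusSLW U k := by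
  refine ⟨TopCat.of F, (range ψ)ᶜ, hF, hL, ?_⟩
  rw [compl_compl]
  exact ⟨hψ.toHomeomorph⟩

end Weight

section Fsigma
variable {Y : Type*} [TopologicalSpace Y]

lemma fs_closed {s : Set Y} (h : IsClosed s) : IsFsigmaSet s :=
  ⟨fun _ => s, fun _ => h, (iUnion_const s).symm⟩

lemma fs_iUnion_closed {F : ℕ → Set Y} (h : ∀ n, IsClosed (F n)) : IsFsigmaSet (⋃ n, F n) :=
  ⟨F, h, rfl⟩

lemma fs_inter {s t : Set Y} (hs : IsFsigmaSet s) (ht : IsFsigmaSet t) : IsFsigmaSet (s ∩ t) := by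
  obtain ⟨F, hF, rfl⟩ := hs
  obtain ⟨G, hG, rfl⟩ := ht
  refine ⟨fun n => F n.unpair.1 ∩ G n.unpair.2, fun n => (hF _).inter (hG _), ?_⟩
  ext x
  simp only [mem_inter_iff, mem_iUnion]
  constructor
  · rintro ⟨⟨i, hi⟩, ⟨j, hj⟩⟩
    exact ⟨Nat.pair i j, by simpa using hi, by simpa using hj⟩
  · rintro ⟨n, h1, h2⟩
    exact ⟨⟨_, h1⟩, ⟨_, h2⟩⟩

lemma fs_open [TopologicalSpace.MetrizableSpace Y] {s : Set Y} (h : IsOpen s) :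
    IsFsigmaSet s := by
  let _ := TopologicalSpace.metrizableSpaceMetric Y
  obtain ⟨F, h1, -, h2, -⟩ := h.exists_iUnion_isClosed
  exact ⟨F, h1, h2.symm⟩

end Fsigma

section Abs
variable {S : Type u} [TopologicalSpace S] [DiscreteTopology S]

lemma absFsd_of_fsd {s : Set (ℕ → S)} (hs : IsFsigmaDelta s) : AbsFsigmaDelta ↥s := by
  refine ⟨inferInstance, ?_⟩
  intro Y _ _ f hf
  obtain ⟨F, hF, hsF⟩ := hs
  choose D hD hFD using hF
  let R : ℕ → Set Y := fun n => ⋃₀ {W | IsOpen W ∧ ∃ a, ∀ x : ↥s, f x ∈ W → x.1 n = a}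
  let O : Set (ℕ → S) → Set Y := fun E =>
    ⋃₀ {W | IsOpen W ∧ ∃ z n, cyl z n ∩ E = ∅ ∧ ∀ x : ↥s, f x ∈ W → x.1 ∈ cyl z n}
  have hRo : ∀ n, IsOpen (R n) := fun n => isOpen_sUnion fun W hW => hW.1
  have hOo : ∀ E, IsOpen (O E) := fun n => isOpen_sUnion fun W hW => hW.1
  -- approximations
  have hg : ∀ y, y ∈ closure (range f) → (∀ n, y ∈ R n) → ∃ z : ℕ → S, ∀ n, ∃ W, IsOpen W ∧ y ∈ W ∧
      ∀ x : ↥s, f x ∈ W → x.1 ∈ cyl z n := by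
    intro y _ hyR
    choose W hW hyW using hyR
    choose hWo a ha using hW
    refine ⟨a, fun n => ⟨⋂ i ∈ Finset.range n, W i, ?_, ?_, ?_⟩⟩
    · exact isOpen_biInter_finset fun i _ => hWo i
    · simp only [mem_iInter]
      exact fun i _ => hyW i
    · intro x hx i hi
      simp only [mem_iInter] at hx
      exact ha i x (hx i (Finset.mem_range.mpr hi))
  have key : range f = ⋂ n, (closure (range f) ∩ R n) ∩ ⋃ m, (O (D n m))ᶜ := by
    ext y
    constructor
    · rintro ⟨x, rfl⟩
      have hopen : ∀ n, ∃ W, IsOpen W ∧ f x ∈ W ∧ ∀ x' : ↥s, f x' ∈ W → x'.1 ∈ cyl x.1 n := by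
        intro n
        have h1 : IsOpen (Subtype.val ⁻¹' cyl x.1 n : Set ↥s) :=
          (cyl_clopen x.1 n).isOpen.preimage continuous_subtype_val
        obtain ⟨W, hW, hWe⟩ := hf.isInducing.isOpen_iff.mp h1
        refine ⟨W, hW, ?_, ?_⟩
        · have : x ∈ f ⁻¹' W := by rw [hWe]; exact self_mem_cyl _ _
          exact this
        · intro x' hx'
          have : x' ∈ f ⁻¹' W := hx'
          rw [hWe] at this
          exact this
      rw [mem_iInter]
      intro n
      refine ⟨⟨subset_closure ⟨x, rfl⟩, ?_⟩, ?_⟩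
      · obtain ⟨W, hW, hxW, h⟩ := hopen (n + 1)
        exact ⟨W, ⟨hW, x.1 n, fun x' hx' => h x' hx' n (Nat.lt_succ_self n)⟩, hxW⟩
      · have hx : x.1 ∈ ⋂ n, F n := hsF.subset x.2
        have hx2 := mem_iInter.mp hx n
        rw [hFD n] at hx2
        obtain ⟨m, hm⟩ := mem_iUnion.mp hx2
        refine mem_iUnion.mpr ⟨m, ?_⟩
        rintro ⟨W, ⟨-, z, l, h1, h2⟩, hxW⟩
        have : x.1 ∈ cyl z l ∩ D n m := ⟨h2 x hxW, hm⟩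
        rw [h1] at this
        exact this
    · intro hy
      rw [mem_iInter] at hy
      have hyc : y ∈ closure (range f) := (hy 0).1.1
      obtain ⟨z, hz⟩ := hg y hyc fun n => (hy n).1.2
      have hzs : z ∈ s := by
        rw [hsF, mem_iInter]
        intro n
        rw [hFD n]
        obtain ⟨m, hm⟩ := mem_iUnion.mp (hy n).2
        refine mem_iUnion.mpr ⟨m, ?_⟩
        by_contra hcon
        apply hm
        obtain ⟨l, hl⟩ := exists_cyl_subset (hD n m).isOpen_compl hcon
        obtain ⟨W, hW, hyW, h⟩ := hz l
        refine ⟨W, ⟨hW, z, l, ?_, h⟩, hyW⟩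
        rw [eq_empty_iff_forall_notMem]
        rintro w ⟨h1, h2⟩
        exact hl h1 h2
      refine ⟨⟨z, hzs⟩, ?_⟩
      by_contra hne
      obtain ⟨W1, W2, hW1, hW2, hf1, hy2, hdis⟩ := t2_separation hne
      have h1 : IsOpen (f ⁻¹' W1) := hW1.preimage hf.continuous
      obtain ⟨W, hW, hWe⟩ := isOpen_induced_iff.mp h1
      have hzW : z ∈ W := by
        have : (⟨z, hzs⟩ : ↥s) ∈ Subtype.val ⁻¹' W := by rw [hWe]; exact hf1
        exact this
      obtain ⟨n, hn⟩ := exists_cyl_subset hW hzW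
      obtain ⟨W3, hW3, hyW3, h3⟩ := hz n
      obtain ⟨y', ⟨hy'2, hy'3⟩, ⟨x, rfl⟩⟩ := mem_closure_iff.mp hyc (W2 ∩ W3) (hW2.inter hW3)
        ⟨hy2, hyW3⟩
      have h4 : x ∈ Subtype.val ⁻¹' W := hn (h3 x hy'3)
      rw [hWe] at h4
      exact Set.disjoint_left.mp hdis h4 hy'2
  rw [key]
  exact ⟨_, fun n => fs_inter (fs_inter (fs_closed isClosed_closure) (fs_open (hRo n)))
    (fs_iUnion_closed fun m => (hOo _).isClosed_compl), rfl⟩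

end Abs
end AIIproof

namespace AIIproof
section Ideal
variable {S : Type u} [TopologicalSpace S] [DiscreteTopology S]

/-- The concrete ideal. -/
def Idl (A : Set (ℕ → S)) (k : Cardinal.{u}) (P : Set (ℕ → S)) : Prop :=
  ∃ G L : ℕ → Set (ℕ → S), P ⊆ ⋃ n, (G n ∪ L n) ∧
    ∀ n, IsGδ (G n) ∧ G n ⊆ A ∧ LocallyWeightLT ↥(L n) k

lemma locallyWeightLT_empty {k : Cardinal.{u}} :
    LocallyWeightLT ↥(∅ : Set (ℕ → S)) k := fun x => (Set.notMem_empty _ x.2).elim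

lemma idealAx_idl (A : Set (ℕ → S)) (k : Cardinal.{u}) : IdealAx A k (Idl A k) where
  mono := by
    rintro P Q ⟨G, L, h, h'⟩ hQ
    exact ⟨G, L, hQ.trans h, h'⟩
  union := by
    intro P h
    choose G L h1 h2 using h
    refine ⟨fun m => G m.unpair.1 m.unpair.2, fun m => L m.unpair.1 m.unpair.2, ?_,
      fun m => h2 _ _⟩
    intro x hx
    obtain ⟨n, hn⟩ := mem_iUnion.mp hx
    obtain ⟨m, hm⟩ := mem_iUnion.mp (h1 n hn)
    refine mem_iUnion.mpr ⟨Nat.pair n m, ?_⟩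
    simpa using hm
  gd := by
    intro G hG hGA
    refine ⟨fun _ => G, fun _ => ∅, ?_, fun n => ⟨hG, hGA, locallyWeightLT_empty⟩⟩
    intro x hx
    exact mem_iUnion.mpr ⟨0, Or.inl hx⟩
  glue := by
    intro P T hT hd h
    choose! G L h1 h2 using h
    refine ⟨fun n => ⋃ t ∈ T, G t n ∩ t, fun n => ⋃ t ∈ T, L t n ∩ t, ?_, fun n => ⟨?_, ?_, ?_⟩⟩
    · rintro x ⟨hxP, t, ht, hxt⟩
      obtain ⟨n, hn⟩ := mem_iUnion.mp (h1 t ht ⟨hxP, hxt⟩)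
      refine mem_iUnion.mpr ⟨n, ?_⟩
      rcases hn with hn | hn
      · left; simp only [mem_iUnion]; exact ⟨t, ht, hn, hxt⟩
      · right; simp only [mem_iUnion]; exact ⟨t, ht, hn, hxt⟩
    · exact glue_gdelta hT hd _ fun t ht => (h2 t ht n).1
    · intro x hx
      simp only [mem_iUnion] at hx
      obtain ⟨t, ht, hn, hxt⟩ := hx
      exact (h2 t ht n).2.1 hn
    · rw [locallyWeightLT_iff]
      intro x hx
      simp only [mem_iUnion] at hx
      obtain ⟨t, ht, hn, hxt⟩ := hx
      obtain ⟨W, hW, hxW, hw⟩ := locallyWeightLT_iff.mp (h2 t ht n).2.2 x hn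
      refine ⟨W ∩ t, hW.inter (hT t ht), ⟨hxW, hxt⟩, weightLT_subset hw ?_⟩
      rintro y ⟨⟨hyW, hyt⟩, hy⟩
      simp only [mem_iUnion] at hy
      obtain ⟨t', ht', hn', hyt'⟩ := hy
      have : t' = t := by
        by_contra hne
        exact Set.disjoint_left.mp (hd ht' ht hne) hyt' hyt
      subst this
      exact ⟨hyW, hn'⟩
  small := by
    intro P hP
    refine ⟨fun _ => ∅, fun _ => P, ?_, fun n => ⟨IsGδ.empty, empty_subset _, weightLT_locally hP⟩⟩
    intro x hx
    exact mem_iUnion.mpr ⟨0, Or.inr hx⟩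

lemma fs_compl_gd {Y : Type*} [TopologicalSpace Y] {s : Set Y} (h : IsGδ s) :
    IsFsigmaSet sᶜ := by
  obtain ⟨f, hf, rfl⟩ := isGδ_iff_eq_iInter_nat.mp h
  exact ⟨fun n => (f n)ᶜ, fun n => (hf n).isClosed_compl, by rw [compl_iInter]⟩

lemma pos_idl {X : Type u} [TopologicalSpace X] {k : Cardinal.{u}}
    (hnw : NowhereFsdMinusSLW X k) {ι : X → ℕ → S} (hι : IsEmbedding ι) (hd : DenseRange ι)
    {V : Set (ℕ → S)} (hV : IsOpen V) (hne : V.Nonempty) : ¬ Idl (range ι)ᶜ k ((range ι)ᶜ ∩ V) := by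
  rintro ⟨G, L, hsub, h⟩
  obtain ⟨x0, hx0⟩ := hd.exists_mem_open hV hne
  apply hnw (ι ⁻¹' V) (hV.preimage hι.continuous) ⟨x0, hx0⟩
  let F : Set (ℕ → S) := ⋂ n, (V ∩ (G n)ᶜ)
  have hF : IsFsigmaDelta F := ⟨_, fun n => fs_inter (fs_open hV) (fs_compl_gd (h n).1), rfl⟩
  let ψ : ↥(ι ⁻¹' V) → ↥F := fun x => ⟨ι x.1, by
    simp only [F, mem_iInter]
    exact fun n => ⟨x.2, fun hx => (h n).2.1 hx ⟨x.1, rfl⟩⟩⟩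
  have hψ : IsEmbedding ψ := by
    refine IsEmbedding.of_comp ?_ continuous_subtype_val ?_
    · exact (hι.continuous.comp continuous_subtype_val).subtype_mk _
    · exact hι.comp IsEmbedding.subtypeVal
  refine fsd_of_embedding (absFsd_of_fsd hF) hψ ?_
  let q : ↥((range ψ)ᶜ) → ℕ → S := fun y => y.1.1
  have hq : IsInducing q := by
    have : IsInducing ((Subtype.val : ↥F → _) ∘ (Subtype.val : ↥((range ψ)ᶜ) → ↥F)) :=
      IsInducing.subtypeVal.comp IsInducing.subtypeVal
    exact this
  refine ⟨fun n => q ⁻¹' L n, ?_, fun n => locallyWeightLT_preimage (h n).2.2 hq⟩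
  rw [eq_univ_iff_forall]
  rintro ⟨⟨y, hyF⟩, hy⟩
  have hyF' := mem_iInter.mp hyF
  have hyr : y ∉ range ι := by
    rintro ⟨x, rfl⟩
    exact hy ⟨⟨x, (hyF' 0).1⟩, rfl⟩
  obtain ⟨n, hn⟩ := mem_iUnion.mp (hsub ⟨hyr, (hyF' 0).1⟩)
  rcases hn with hn | hn
  · exact absurd hn (hyF' n).2
  · exact mem_iUnion.mpr ⟨n, hn⟩

end Ideal

section Complete

lemma complete_gd {D B : Type*} [MetricSpace D] [CompleteSpace D] [TopologicalSpace B] [T2Space B]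
    {j : D → B} (hj : IsInducing j) (hd : DenseRange j) :
    ∃ G : ℕ → Set B, (∀ n, IsOpen (G n)) ∧ (∀ n, range j ⊆ G n) ∧ ⋂ n, G n ⊆ range j := by
  refine ⟨fun n => ⋃₀ {W | IsOpen W ∧ ∀ a b, j a ∈ W → j b ∈ W → dist a b < 1 / ((n : ℝ) + 1)},
    fun n => isOpen_sUnion fun W hW => hW.1, ?_, ?_⟩
  · rintro n _ ⟨a, rfl⟩
    have hpos : (0 : ℝ) < 1 / ((n : ℝ) + 1) / 2 := by positivity
    obtain ⟨W, hW, hWe⟩ := hj.isOpen_iff.mp (Metric.isOpen_ball (x := a) (ε := 1 / ((n : ℝ) + 1) / 2))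
    refine ⟨W, ⟨hW, ?_⟩, ?_⟩
    · intro b c hb hc
      have hb' : b ∈ j ⁻¹' W := hb
      have hc' : c ∈ j ⁻¹' W := hc
      rw [hWe, Metric.mem_ball] at hb' hc'
      rw [dist_comm] at hc'
      have := dist_triangle b a c
      linarith
    · have : a ∈ j ⁻¹' W := by rw [hWe]; exact Metric.mem_ball_self hpos
      exact this
  · intro y hy
    rw [mem_iInter] at hy
    have : NeBot (comap j (𝓝 y)) := IsDenseInducing.comap_nhds_neBot ⟨hj, hd⟩ y
    have hc : Cauchy (comap j (𝓝 y)) := by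
      rw [Metric.cauchy_iff]
      refine ⟨this, fun ε hε => ?_⟩
      obtain ⟨n, hn⟩ := exists_nat_one_div_lt hε
      obtain ⟨W, ⟨hW, h⟩, hyW⟩ := hy n
      exact ⟨j ⁻¹' W, preimage_mem_comap (hW.mem_nhds hyW), fun a ha b hb => (h a b ha hb).trans hn⟩
    obtain ⟨a, ha⟩ := CompleteSpace.complete hc
    refine ⟨a, ?_⟩
    have h1 : Tendsto j (comap j (𝓝 y)) (𝓝 (j a)) := (hj.continuous.tendsto a).mono_left ha
    exact tendsto_nhds_unique h1 tendsto_comap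

end Complete

section Final
variable {S : Type u} [TopologicalSpace S] [DiscreteTopology S]

lemma iUnion_le_closed {Y : Type*} [TopologicalSpace Y] {O : ℕ → Set Y} (h : ∀ n, IsOpen (O n))
    (m : ℕ) : IsClosed (⋃ i ∈ Finset.range (m + 1), (O i)ᶜ) :=
  isClosed_biUnion_finset fun i _ => (h i).isClosed_compl

lemma iUnion_le_mono {Y : Type*} {O : ℕ → Set Y} :
    Monotone fun m : ℕ => ⋃ i ∈ Finset.range (m + 1), (O i)ᶜ := by
  intro m n hmn x hx
  simp only [mem_iUnion, Finset.mem_range] at hx ⊢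
  obtain ⟨i, hi, hx⟩ := hx
  exact ⟨i, by omega, hx⟩

lemma iUnion_le_eq {Y : Type*} {O : ℕ → Set Y} :
    (⋃ m : ℕ, ⋃ i ∈ Finset.range (m + 1), (O i)ᶜ) = (⋂ i, O i)ᶜ := by
  ext x
  simp only [mem_iUnion, Finset.mem_range, mem_compl_iff, mem_iInter, not_forall]
  constructor
  · rintro ⟨m, i, hi, hx⟩
    exact ⟨i, hx⟩
  · rintro ⟨i, hx⟩
    exact ⟨i, i, by omega, hx⟩

theorem final_of_embedding {X : Type u} [TopologicalSpace X] [Nonempty X] {k : Cardinal.{u}}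
    (hk : Cardinal.aleph0 ≤ k) (hS : Cardinal.mk S ≤ k) (habs : AbsGdeltaSigma X)
    (hnw : NowhereFsdMinusSLW X k) (hcomp : ∃ D : Set X, Dense D ∧ CompletelyMetrizable ↥D)
    {ι : X → ℕ → S} (hι : IsEmbedding ι) (hd : DenseRange ι) :
    Dense (range ι)ᶜ ∧ Nonempty (↥((range ι)ᶜ) ≃ₜ QkOmega k) := by
  have hax := idealAx_idl (range ι)ᶜ k
  have hpos : ∀ V, IsOpen V → V.Nonempty → ¬ Idl (range ι)ᶜ k ((range ι)ᶜ ∩ V) :=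
    fun V hV hne => pos_idl hnw hι hd hV hne
  refine ⟨?_, ?_⟩
  · rw [dense_iff_inter_open]
    intro V hV hne
    by_contra hcon
    apply hpos V hV hne
    rw [Set.not_nonempty_iff_eq_empty] at hcon
    rw [inter_comm, hcon]
    exact hax.gd _ IsGδ.empty (empty_subset _)
  · obtain ⟨H, hH, hHe⟩ := habs.2 (ℕ → S) ι hι
    have hH' : ∀ n, ∃ O : ℕ → Set (ℕ → S), (∀ i, IsOpen (O i)) ∧ H n = ⋂ i, O i :=
      fun n => isGδ_iff_eq_iInter_nat.mp (hH n)
    choose O hO hHO using hH'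
    have hP : Pres (range ι)ᶜ fun n m => ⋃ i ∈ Finset.range (m + 1), (O n i)ᶜ := by
      refine ⟨fun n m => iUnion_le_closed (hO n) m, fun n => iUnion_le_mono, ?_⟩
      rw [hHe, compl_iUnion]
      congr 1
      funext n
      rw [iUnion_le_eq, hHO n]
    have hG : Good (range ι)ᶜ (Idl (range ι)ᶜ k) univ := by
      refine ⟨isClosed_univ, ?_, ?_, ?_⟩
      · exact ⟨ι (Classical.arbitrary X), trivial⟩
      · intro V hV hne
        rw [inter_univ] at hne ⊢
        exact hpos V hV hne
      · obtain ⟨D, hD, m, hm, hmc⟩ := hcomp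
        have hj : IsInducing (ι ∘ (Subtype.val : ↥D → X)) := hι.isInducing.comp IsInducing.subtypeVal
        have hjd : DenseRange (ι ∘ (Subtype.val : ↥D → X)) :=
          hd.comp hD.denseRange_val hι.continuous
        obtain ⟨G, hGo, hGr, hGi⟩ : ∃ G : ℕ → Set (ℕ → S), (∀ n, IsOpen (G n)) ∧
            (∀ n, range (ι ∘ (Subtype.val : ↥D → X)) ⊆ G n) ∧
            ⋂ n, G n ⊆ range (ι ∘ (Subtype.val : ↥D → X)) := by
          exact @complete_gd ↥D (ℕ → S) m hmc _ _ _ (by rw [hm]; exact hj) hjd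
        refine ⟨fun m => ⋃ i ∈ Finset.range (m + 1), (G i)ᶜ, iUnion_le_mono,
          fun m => iUnion_le_closed hGo m, ?_, ?_⟩
        · rw [iUnion_le_eq, inter_univ]
          apply compl_subset_compl.mpr
          refine hGi.trans ?_
          rintro _ ⟨x, rfl⟩
          exact ⟨x.1, rfl⟩
        · intro m V hV hne
          rw [inter_univ] at hne ⊢
          obtain ⟨d, hd'⟩ := hjd.exists_mem_open hV hne
          refine ⟨_, hd', ?_⟩
          simp only [mem_iUnion, not_exists]
          intro i _ hx
          exact hx (hGr i ⟨d, rfl⟩)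
    obtain ⟨e1⟩ := tree_homeo hk hS hax hP hG
    obtain ⟨e2⟩ := model_homeo hk
    exact ⟨e1.trans e2.symm⟩

end Final
end AIIproof

namespace AIIproof

section Partition

lemma exists_partition {X : Type u} [MetricSpace X] (hind : StronglyZeroDim X) {ε : ℝ}
    (hε : 0 < ε) : ∃ e : X → X, (∀ x, ∀ᶠ y in 𝓝 x, e y = e x) ∧
      ∀ x y, e x = e y → dist x y < ε := by
  classical
  obtain ⟨v, hvo, hvc, hvf, hvu⟩ := precise_refinement (fun x : X => Metric.ball x (ε / 2))
    (fun x => Metric.isOpen_ball) (by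
      rw [eq_univ_iff_forall]
      exact fun x => mem_iUnion.mpr ⟨x, Metric.mem_ball_self (by linarith)⟩)
  obtain ⟨F, hFc, hFcl, hFv⟩ := exists_iUnion_eq_closed_subset hvo (fun x => hvf.point_finite x) hvc
  have hC : ∀ i, ∃ C : Set X, IsClopen C ∧ F i ⊆ C ∧ C ⊆ v i := by
    intro i
    obtain ⟨C, h1, h2, h3⟩ := hind (F i) (v i)ᶜ (hFcl i) (hvo i).isClosed_compl
      (disjoint_compl_right.mono_left (hFv i))
    exact ⟨C, h1, h2, disjoint_compl_left_iff_subset.mp h3⟩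
  choose C hCc hFC hCv using hC
  have hCf : LocallyFinite C := hvf.subset hCv
  have hcov : ∀ x, ∃ i, x ∈ C i := by
    intro x
    obtain ⟨i, hi⟩ := mem_iUnion.mp (hFc.symm.subset (mem_univ x))
    exact ⟨i, hFC i hi⟩
  rcases isEmpty_or_nonempty X with hX | hX
  · exact ⟨id, fun x => isEmptyElim x, fun x => isEmptyElim x⟩
  have hg : ∀ s : Set X, ∃ i : X, s.Nonempty → i ∈ s := by
    intro s
    by_cases hs : s.Nonempty
    · exact ⟨hs.some, fun _ => hs.some_mem⟩
    · exact ⟨Classical.arbitrary X, fun h => absurd h hs⟩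
  choose g hg using hg
  have hge : ∀ x, x ∈ C (g {i | x ∈ C i}) := fun x => hg {i | x ∈ C i} (hcov x)
  refine ⟨fun x => g {i | x ∈ C i}, ?_, ?_⟩
  · intro x
    obtain ⟨N, hN, hfin⟩ := hCf x
    have h1 : ∀ i ∈ {i | (C i ∩ N).Nonempty}, ∀ᶠ y in 𝓝 x, (y ∈ C i ↔ x ∈ C i) := by
      intro i _
      by_cases hx : x ∈ C i
      · filter_upwards [(hCc i).isOpen.mem_nhds hx] with y hy
        exact ⟨fun _ => hx, fun _ => hy⟩
      · filter_upwards [(hCc i).compl.isOpen.mem_nhds hx] with y hy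
        exact ⟨fun h => absurd h hy, fun h => absurd h hx⟩
    filter_upwards [hN, (eventually_all_finite hfin).mpr h1] with y hyN hy
    congr 1
    ext i
    show y ∈ C i ↔ x ∈ C i
    by_cases hi : (C i ∩ N).Nonempty
    · exact hy i hi
    · constructor
      · intro h
        exact absurd ⟨y, h, hyN⟩ hi
      · intro h
        exact absurd ⟨x, h, mem_of_mem_nhds hN⟩ hi
  · intro x y hxy
    have hx := hvu _ (hCv _ (hge x))
    have hy := hvu _ (hCv _ (hge y))
    dsimp only at hxy
    rw [← hxy] at hy
    rw [Metric.mem_ball] at hx hy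
    have := dist_triangle_right x y (g {i | x ∈ C i})
    linarith

/-- `X` with the discrete topology. -/
def Dsc (X : Type u) : Type u := X

instance (X : Type u) : TopologicalSpace (Dsc X) := ⊥
instance (X : Type u) : DiscreteTopology (Dsc X) := ⟨rfl⟩

lemma embedding_of_sep {X S : Type u} [TopologicalSpace X] [T0Space X] [TopologicalSpace S]
    [DiscreteTopology S] {φ : X → ℕ → S} (hloc : ∀ n x, ∀ᶠ y in 𝓝 x, φ y n = φ x n)
    (hsep : ∀ U : Set X, IsOpen U → ∀ x ∈ U, ∃ n, ∀ y, φ y ∈ cyl (φ x) n → y ∈ U) :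
    IsEmbedding φ := by
  have hc : Continuous φ := continuous_pi fun n => continuous_of_locconst _ (hloc n)
  have hi : IsInducing φ := by
    rw [isInducing_iff_nhds]
    intro x
    apply le_antisymm
    · exact (hc.tendsto x).le_comap
    · intro U hU
      obtain ⟨O, hOU, hO, hxO⟩ := mem_nhds_iff.mp hU
      obtain ⟨n, hn⟩ := hsep O hO x hxO
      exact ⟨cyl (φ x) n, (cyl_clopen _ _).isOpen.mem_nhds (self_mem_cyl _ _),
        fun y hy => hOU (hn y hy)⟩
  exact hi.isEmbedding

lemma exists_phi {X : Type u} [TopologicalSpace X] [TopologicalSpace.MetrizableSpace X]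
    (hind : StronglyZeroDim X) : ∃ φ : X → ℕ → Dsc X, IsEmbedding φ := by
  let _ := TopologicalSpace.metrizableSpaceMetric X
  have h : ∀ n : ℕ, ∃ e : X → X, (∀ x, ∀ᶠ y in 𝓝 x, e y = e x) ∧
      ∀ x y, e x = e y → dist x y < 1 / ((n : ℝ) + 1) :=
    fun n => exists_partition hind (by positivity)
  choose e he1 he2 using h
  let φ : X → ℕ → Dsc X := fun x n => e n x
  refine ⟨φ, embedding_of_sep (S := Dsc X) (φ := φ) he1 ?_⟩
  intro U hU x hx
  obtain ⟨ε, hε, hball⟩ := Metric.isOpen_iff.mp hU x hx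
  obtain ⟨n, hn⟩ := exists_nat_one_div_lt hε
  refine ⟨n + 1, fun y hy => hball ?_⟩
  exact (he2 n y x (hy n (Nat.lt_succ_self n))).trans hn

lemma sep_of_embedding {X S : Type u} [TopologicalSpace X] [TopologicalSpace S]
    [DiscreteTopology S] {φ : X → ℕ → S} (hφ : IsEmbedding φ) :
    ∀ U : Set X, IsOpen U → ∀ x ∈ U, ∃ n, ∀ y, φ y ∈ cyl (φ x) n → y ∈ U := by
  intro U hU x hx
  obtain ⟨W, hW, rfl⟩ := hφ.isInducing.isOpen_iff.mp hU
  obtain ⟨n, hn⟩ := exists_cyl_subset hW hx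
  exact ⟨n, fun y hy => hn hy⟩

lemma thick_image {X S : Type u} [TopologicalSpace X] [TopologicalSpace S]
    [DiscreteTopology S] {φ : X → ℕ → S} (hφ : IsEmbedding φ) {k : Cardinal.{u}}
    (hk : Cardinal.aleph0 ≤ k) (hnw : NowhereFsdMinusSLW X k) {U : Set X} (hU : IsOpen U)
    (hne : U.Nonempty) : Thick k (φ '' U) := by
  have h1 : ¬ WeightLT ↥(closure (φ '' U)) k := by
    intro hw
    apply hnw U hU hne
    have hF : IsFsigmaDelta (closure (φ '' U)) :=
      ⟨fun _ => closure (φ '' U), fun _ => fs_closed isClosed_closure, (iInter_const _).symm⟩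
    let ψ : ↥U → ↥(closure (φ '' U)) := fun x => ⟨φ x.1, subset_closure ⟨x.1, x.2, rfl⟩⟩
    have hψ : IsEmbedding ψ := by
      refine IsEmbedding.of_comp ?_ continuous_subtype_val ?_
      · exact (hφ.continuous.comp continuous_subtype_val).subtype_mk _
      · exact hφ.comp IsEmbedding.subtypeVal
    refine fsd_of_embedding (absFsd_of_fsd hF) hψ ⟨fun _ => univ, iUnion_const _, fun _ => ?_⟩
    refine weightLT_locally (weightLT_of_inducing (weightLT_of_inducing hw
      (f := (Subtype.val : ↥((range ψ)ᶜ) → _)) IsInducing.subtypeVal)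
      (f := Subtype.val) IsInducing.subtypeVal)
  intro l hl
  obtain ⟨n, hn⟩ := thick_of_not_weightLT hk h1 l hl
  refine ⟨n, hn.trans_le (Cardinal.mk_le_mk_of_subset ?_)⟩
  rintro _ ⟨x, hx, rfl⟩
  obtain ⟨y, hy1, hy2⟩ := mem_closure_iff.mp hx (cyl x n) (cyl_clopen _ _).isOpen (self_mem_cyl _ _)
  exact ⟨y, hy2, cyl_eq hy1⟩

lemma tree_embedding {X S Z : Type u} [TopologicalSpace X] [T0Space X] [Nonempty X]
    [TopologicalSpace S] [DiscreteTopology S] (e : ℕ → X → Z)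
    (hsep : ∀ U : Set X, IsOpen U → ∀ x ∈ U, ∃ n, ∀ y, (∀ i < n, e i y = e i x) → y ∈ U)
    (hsplit : ∀ U : Set X, IsClopen U → U.Nonempty → ∀ n, ∃ c : X → S,
      (∀ a, IsClopen (U ∩ c ⁻¹' {a}) ∧ (U ∩ c ⁻¹' {a}).Nonempty) ∧
      ∀ x ∈ U, ∀ y ∈ U, c x = c y → e n x = e n y) :
    ∃ ι : X → ℕ → S, IsEmbedding ι ∧ DenseRange ι := by
  let σ : ℕ → Type u := fun _ => {U : Set X // IsClopen U ∧ U.Nonempty}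
  let Λ : ℕ → Type u := fun _ => S
  have h : ∀ n (U : σ n), ∃ c : X → S,
      (∀ a, IsClopen (U.1 ∩ c ⁻¹' {a}) ∧ (U.1 ∩ c ⁻¹' {a}).Nonempty) ∧
      ∀ x ∈ U.1, ∀ y ∈ U.1, c x = c y → e n x = e n y :=
    fun n U => hsplit U.1 U.2.1 U.2.2 n
  choose c hc1 hc2 using h
  let next : ∀ n, σ n → Λ n → σ (n + 1) := fun n U a => ⟨U.1 ∩ c n U ⁻¹' {a}, hc1 n U a⟩
  let s0 : σ 0 := ⟨univ, isClopen_univ, univ_nonempty⟩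
  let st : (∀ n, Λ n) → ∀ n, σ n := fun s => branch (Λ := Λ) s0 next s
  let fl : X → ∀ n, σ n := fun x => follow (Λ := Λ) s0 next (fun n U => c n U x)
  let ι : X → ℕ → S := fun x n => c n (fl x n) x
  have hst : ∀ s n, (st s (n + 1)).1 = (st s n).1 ∩ c n (st s n) ⁻¹' {s n} := fun _ _ => rfl
  have hfl : ∀ x n, st (ι x) n = fl x n := fun x n =>
    branch_follow (Λ := Λ) s0 next (fun n U => c n U x) n
  have hself : ∀ x n, x ∈ (st (ι x) n).1 := by
    intro x n
    induction n with
    | zero => trivial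
    | succ n ih =>
      rw [hst]
      refine ⟨ih, ?_⟩
      show c n (st (ι x) n) x = ι x n
      rw [hfl]
  have hmem : ∀ x s n, x ∈ (st s n).1 ↔ ι x ∈ cyl s n := by
    intro x s n
    constructor
    · induction n with
      | zero => intro _ i hi; omega
      | succ n ih =>
        intro hx i hi
        rw [hst] at hx
        have h1 := ih hx.1
        rcases Nat.lt_or_ge i n with h | h
        · exact h1 i h
        · obtain rfl : i = n := by omega
          have h2 : c i (st s i) x = s i := hx.2
          have h3 : st s i = st (ι x) i :=
            branch_congr (Λ := Λ) s0 next s (ι x) i fun j hj => (h1 j hj).symm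
          rw [h3, hfl] at h2
          exact h2
    · intro hx
      have h3 : st s n = st (ι x) n :=
        branch_congr (Λ := Λ) s0 next s (ι x) n fun j hj => (hx j hj).symm
      rw [h3]
      exact hself x n
  refine ⟨ι, embedding_of_sep ?_ ?_, ?_⟩
  · intro n x
    filter_upwards [(st (ι x) (n + 1)).2.1.isOpen.mem_nhds (hself x (n + 1))] with y hy
    exact (hmem y (ι x) (n + 1)).mp hy n (Nat.lt_succ_self n)
  · intro U hU x hx
    obtain ⟨n, hn⟩ := hsep U hU x hx
    refine ⟨n, fun y hy => hn y fun i hi => ?_⟩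
    have hy' : y ∈ (st (ι x) (i + 1)).1 := (hmem y _ _).mpr (cyl_anti _ (by omega) hy)
    have hx' := hself x (i + 1)
    rw [hst] at hx' hy'
    refine hc2 i _ y hy'.1 x hx'.1 ?_
    have h1 : c i (st (ι x) i) y = ι x i := hy'.2
    have h2 : c i (st (ι x) i) x = ι x i := hx'.2
    rw [h1, h2]
  · show Dense (range ι)
    rw [dense_iff_inter_open]
    rintro V hV ⟨s, hs⟩
    obtain ⟨n, hn⟩ := exists_cyl_subset hV hs
    obtain ⟨x, hx⟩ := (st s n).2.2
    exact ⟨ι x, hn ((hmem x s n).mp hx), x, rfl⟩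

lemma exists_base {X : Type u} [TopologicalSpace X] :
    ∃ B : Set (Set X), TopologicalSpace.IsTopologicalBasis B ∧ Cardinal.mk B = topWeight X := by
  have : Nonempty {B : Set (Set X) // TopologicalSpace.IsTopologicalBasis B} :=
    ⟨⟨_, TopologicalSpace.isTopologicalBasis_opens⟩⟩
  obtain ⟨B, hB⟩ := ciInf_mem
    fun B : {B : Set (Set X) // TopologicalSpace.IsTopologicalBasis B} => Cardinal.mk B.1
  exact ⟨B.1, B.2, hB⟩

lemma mk_disjoint_le {X J : Type u} [TopologicalSpace X] {B : Set (Set X)}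
    (hB : TopologicalSpace.IsTopologicalBasis B) (O : J → Set X) (ho : ∀ j, IsOpen (O j))
    (hne : ∀ j, (O j).Nonempty) (hd : ∀ i j, i ≠ j → Disjoint (O i) (O j)) :
    Cardinal.mk J ≤ Cardinal.mk B := by
  have h : ∀ j, ∃ b : B, (b.1).Nonempty ∧ b.1 ⊆ O j := by
    intro j
    obtain ⟨x, hx⟩ := hne j
    obtain ⟨b, hb, hxb, hbO⟩ := hB.exists_subset_of_mem_open hx (ho j)
    exact ⟨⟨b, hb⟩, ⟨x, hxb⟩, hbO⟩
  choose b hb1 hb2 using h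
  refine Cardinal.mk_le_of_injective (f := b) ?_
  intro i j hij
  by_contra hne
  obtain ⟨x, hx⟩ := hb1 i
  exact Set.disjoint_left.mp (hd i j hne) (hb2 i hx) (hb2 j (hij ▸ hx))

end Partition
end AIIproof

namespace AIIproof

section Split

lemma split_uncountable {X S Z : Type u} [TopologicalSpace X] [TopologicalSpace Z]
    [DiscreteTopology Z] {φ : X → ℕ → Z} (hφ : IsEmbedding φ) {k : Cardinal.{u}}
    (hk : Cardinal.aleph0 < k) (hS : Cardinal.mk S = k) (hnw : NowhereFsdMinusSLW X k)
    (hw : topWeight X = k) (U : Set X) (hU : IsClopen U) (hne : U.Nonempty) (n : ℕ) :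
    ∃ c : X → S, (∀ a, IsClopen (U ∩ c ⁻¹' {a}) ∧ (U ∩ c ⁻¹' {a}).Nonempty) ∧
      ∀ x ∈ U, ∀ y ∈ U, c x = c y → φ x n = φ y n := by
  classical
  obtain ⟨n0, hn0⟩ := thick_image hφ hk.le hnw hU.isOpen hne _ hk
  let P := φ '' U
  let T := cnt n0 P
  have hTc : ∀ t ∈ T, IsCyl t := by
    rintro _ ⟨x, -, rfl⟩
    exact ⟨x, n0, rfl⟩
  have hTd : T.PairwiseDisjoint id := by
    rintro _ ⟨x, -, rfl⟩ _ ⟨y, -, rfl⟩ hxy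
    rw [Function.onFun, Set.disjoint_left]
    intro z hz1 hz2
    apply hxy
    show cyl x n0 = cyl y n0
    rw [← cyl_eq hz1, ← cyl_eq hz2]
  have hinf : Infinite T := Cardinal.infinite_iff.mpr hn0.le
  let e : ℕ → Set (ℕ → Z) := fun l => (Infinite.natEmbedding T l).1
  have he : Function.Injective e := fun a b h =>
    (Infinite.natEmbedding T).injective (Subtype.ext h)
  have heT : ∀ l, e l ∈ T := fun l => (Infinite.natEmbedding T l).2
  have hth : ∀ l, Thick k (P ∩ e l) := by
    intro l
    have h1 : P ∩ e l = φ '' (U ∩ φ ⁻¹' e l) := (Set.image_inter_preimage φ U (e l)).symm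
    rw [h1]
    refine thick_image hφ hk.le hnw
      (hU.isOpen.inter ((hTc _ (heT l)).clopen.isOpen.preimage hφ.continuous)) ?_
    obtain ⟨_, ⟨x, hx, rfl⟩, hxe⟩ := heT l
    refine ⟨x, hx, ?_⟩
    show φ x ∈ e l
    rw [← hxe]
    exact self_mem_cyl _ _
  obtain ⟨R, hR, hRd, hRT, hRk⟩ := refine_family P T hTc hTd e he heT hth (n + 1)
  let R' : Set (Set (ℕ → Z)) := {t | t ∈ R ∧ (t ∩ P).Nonempty}
  have hle : Cardinal.mk R' ≤ k := by
    obtain ⟨B, hB, hBk⟩ := exists_base (X := X)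
    rw [← hw, ← hBk]
    refine mk_disjoint_le hB (fun t : R' => φ ⁻¹' t.1) ?_ ?_ ?_
    · exact fun t => (hR t.1 t.2.1).1.clopen.isOpen.preimage hφ.continuous
    · rintro ⟨t, -, _, hx, x, -, rfl⟩
      exact ⟨x, hx⟩
    · intro i j hij
      refine Disjoint.preimage _ (hRd i.2.1 j.2.1 ?_)
      exact fun h => hij (Subtype.ext h)
  have hmk : Cardinal.mk R' = Cardinal.mk S := by
    rw [hS]; exact le_antisymm hle hRk
  obtain ⟨E⟩ := Cardinal.eq.mp hmk
  have hcov : ∀ x : X, ∃ t : R', x ∈ U → φ x ∈ t.1 := by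
    intro x
    by_cases hx : x ∈ U
    · have h1 : φ x ∈ ⋃₀ T := ⟨cyl (φ x) n0, ⟨φ x, ⟨x, hx, rfl⟩, rfl⟩, self_mem_cyl _ _⟩
      rw [← hRT] at h1
      obtain ⟨t, ht, hxt⟩ := h1
      exact ⟨⟨t, ht, φ x, hxt, x, hx, rfl⟩, fun _ => hxt⟩
    · have : Nonempty R' := by
        rw [← Cardinal.mk_ne_zero_iff]
        exact ((Cardinal.aleph0_pos.trans hk).trans_le hRk).ne'
      exact ⟨Classical.arbitrary _, fun h => absurd h hx⟩
  choose q hq using hcov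
  have huniq : ∀ x ∈ U, ∀ t : R', φ x ∈ t.1 → q x = t := by
    intro x hx t ht
    by_contra hcon
    refine Set.disjoint_left.mp (hRd (q x).2.1 t.2.1 ?_) (hq x hx) ht
    exact fun h => hcon (Subtype.ext h)
  refine ⟨fun x => E (q x), ?_, ?_⟩
  · intro a
    have h1 : U ∩ (fun x => E (q x)) ⁻¹' {a} = U ∩ φ ⁻¹' (E.symm a).1 := by
      ext x
      constructor
      · rintro ⟨hx, h⟩
        refine ⟨hx, ?_⟩
        have h2 : E (q x) = a := h
        rw [← h2, Equiv.symm_apply_apply]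
        exact hq x hx
      · rintro ⟨hx, h⟩
        refine ⟨hx, ?_⟩
        show E (q x) = a
        rw [huniq x hx _ h, Equiv.apply_symm_apply]
    rw [h1]
    refine ⟨hU.inter ((hR _ (E.symm a).2.1).1.clopen.preimage hφ.continuous), ?_⟩
    obtain ⟨_, hx, x, hxU, rfl⟩ := (E.symm a).2.2
    exact ⟨x, hxU, hx⟩
  · intro x hx y hy hxy
    have h1 : q x = q y := E.injective hxy
    have h2 := hq y hy
    rw [← h1] at h2
    exact (hR _ (q x).2.1).2.1 _ (hq x hx) _ h2 n (Nat.lt_succ_self n)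

lemma split_bool {X S : Type u} [TopologicalSpace X] (E : S ≃ Bool) {U W : Set X}
    (hU : IsClopen U) (hW : IsClopen W) (h1 : (U ∩ W).Nonempty) (h2 : (U \ W).Nonempty) :
    ∃ c : X → S, (∀ a, IsClopen (U ∩ c ⁻¹' {a}) ∧ (U ∩ c ⁻¹' {a}).Nonempty) ∧
      ∀ x ∈ U, ∀ y ∈ U, c x = c y → (x ∈ W ↔ y ∈ W) := by
  classical
  refine ⟨fun x => E.symm (decide (x ∈ W)), ?_, ?_⟩
  · intro a
    obtain ⟨b, rfl⟩ := E.symm.surjective a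
    have h3 : (fun x => E.symm (decide (x ∈ W))) ⁻¹' {E.symm b} = {x | decide (x ∈ W) = b} := by
      ext x
      exact E.symm.injective.eq_iff
    rw [h3]
    cases b
    · have h4 : {x | decide (x ∈ W) = false} = Wᶜ := by
        ext x
        exact decide_eq_false_iff_not
      rw [h4]
      exact ⟨hU.inter hW.compl, h2⟩
    · have h4 : {x | decide (x ∈ W) = true} = W := by
        ext x
        exact decide_eq_true_iff
      rw [h4]
      exact ⟨hU.inter hW, h1⟩
  · intro x _ y _ hxy
    exact decide_eq_decide.mp (E.symm.injective hxy)

lemma embed_countable {X S : Type u} [TopologicalSpace X] [TopologicalSpace.MetrizableSpace X]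
    [Nonempty X] [TopologicalSpace S] [DiscreteTopology S] (E : S ≃ Bool)
    (hind : StronglyZeroDim X) (hnw : NowhereFsdMinusSLW X Cardinal.aleph0)
    (hw : topWeight X = Cardinal.aleph0) : ∃ ι : X → ℕ → S, IsEmbedding ι ∧ DenseRange ι := by
  classical
  obtain ⟨φ, hφ⟩ := exists_phi hind
  obtain ⟨B, hB, hBk⟩ := exists_base (X := X)
  rw [hw] at hBk
  have hBc : B.Countable := Cardinal.le_aleph0_iff_set_countable.mp hBk.le
  have hBn : B.Nonempty := by
    obtain ⟨b, hb, -⟩ := hB.exists_subset_of_mem_open (mem_univ (Classical.arbitrary X)) isOpen_univ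
    exact ⟨b, hb⟩
  obtain ⟨b, rfl⟩ := hBc.exists_eq_range hBn
  have hV : ∀ n : ℕ, ∃ V : Set X, IsClopen V ∧ (closure (b n.unpair.1) ⊆ b n.unpair.2 →
      closure (b n.unpair.1) ⊆ V ∧ V ⊆ b n.unpair.2) := by
    intro n
    by_cases h : closure (b n.unpair.1) ⊆ b n.unpair.2
    · obtain ⟨V, h1, h2, h3⟩ := hind (closure (b n.unpair.1)) (b n.unpair.2)ᶜ isClosed_closure
        (hB.isOpen ⟨_, rfl⟩).isClosed_compl (disjoint_compl_right.mono_left h)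
      exact ⟨V, h1, fun _ => ⟨h2, disjoint_compl_left_iff_subset.mp h3⟩⟩
    · exact ⟨∅, isClopen_empty, fun h' => absurd h' h⟩
  choose V hVc hVb using hV
  refine tree_embedding (Z := ULift.{u} Prop) (fun n x => ⟨x ∈ V n⟩) ?_ ?_
  · intro U hU x hx
    obtain ⟨_, ⟨j, rfl⟩, hxj, hjU⟩ := hB.exists_subset_of_mem_open hx hU
    obtain ⟨_, ⟨i, rfl⟩, hxi, hij⟩ := hB.exists_closure_subset
      ((hB.isOpen ⟨j, rfl⟩).mem_nhds hxj)
    refine ⟨Nat.pair i j + 1, fun y hy => hjU ?_⟩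
    have h1 := hVb (Nat.pair i j)
    simp only [Nat.unpair_pair] at h1
    have h2 := ULift.up_injective (hy (Nat.pair i j) (Nat.lt_succ_self _))
    apply (h1 hij).2
    have h3 : x ∈ V (Nat.pair i j) := (h1 hij).1 (subset_closure hxi)
    exact h2.symm.mp h3
  · intro U hU hne n
    by_cases hsp : (U ∩ V n).Nonempty ∧ (U \ V n).Nonempty
    · obtain ⟨c, h1, h2⟩ := split_bool E hU (hVc n) hsp.1 hsp.2
      refine ⟨c, h1, fun x hx y hy hxy => ?_⟩
      rw [propext (h2 x hx y hy hxy)]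
    · obtain ⟨m, hm⟩ := thick_image hφ le_rfl hnw hU.isOpen hne 1 Cardinal.one_lt_aleph0
      rw [Cardinal.one_lt_iff_nontrivial] at hm
      obtain ⟨⟨_, _, ⟨x, hx, rfl⟩, rfl⟩, ⟨_, _, ⟨y, hy, rfl⟩, rfl⟩, hxy⟩ := hm
      obtain ⟨c, h1, -⟩ := split_bool E hU
        ((cyl_clopen (φ x) m).preimage hφ.continuous) ⟨x, hx, self_mem_cyl _ _⟩
        ⟨y, hy, fun h => hxy (Subtype.ext (cyl_eq h).symm)⟩
      refine ⟨c, h1, fun x hx y hy _ => ?_⟩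
      congr 1
      apply propext
      rw [not_and_or] at hsp
      rcases hsp with h | h
      · exact ⟨fun h' => absurd ⟨x, hx, h'⟩ h, fun h' => absurd ⟨y, hy, h'⟩ h⟩
      · constructor
        · intro _
          by_contra h'
          exact h ⟨y, hy, h'⟩
        · intro _
          by_contra h'
          exact h ⟨x, hx, h'⟩

lemma embed_uncountable {X S : Type u} [TopologicalSpace X] [TopologicalSpace.MetrizableSpace X]
    [Nonempty X] [TopologicalSpace S] [DiscreteTopology S] {k : Cardinal.{u}}
    (hk : Cardinal.aleph0 < k) (hS : Cardinal.mk S = k)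
    (hind : StronglyZeroDim X) (hnw : NowhereFsdMinusSLW X k)
    (hw : topWeight X = k) : ∃ ι : X → ℕ → S, IsEmbedding ι ∧ DenseRange ι := by
  obtain ⟨φ, hφ⟩ := exists_phi hind
  exact tree_embedding (fun n x => φ x n) (sep_of_embedding hφ)
    fun U hU hne n => split_uncountable hφ hk hS hnw hw U hU hne n

theorem main {k : Cardinal.{u}} (hk : Cardinal.aleph0 ≤ k) {X : Type u} [TopologicalSpace X]
    (habs : AbsGdeltaSigma X) (hind : StronglyZeroDim X) (hnw : NowhereFsdMinusSLW X k)
    (hcomp : ∃ D : Set X, Dense D ∧ CompletelyMetrizable ↥D) (hw : topWeight X = k) :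
    IsAII k X := by
  have := habs.1
  have hX : Nonempty X := by
    by_contra hcon
    rw [not_nonempty_iff] at hcon
    have h0 : TopologicalSpace.IsTopologicalBasis (∅ : Set (Set X)) :=
      TopologicalSpace.isTopologicalBasis_of_isOpen_of_nhds (by simp) fun a => isEmptyElim a
    have h1 : topWeight X ≤ Cardinal.mk (∅ : Set (Set X)) :=
      ciInf_le' (fun B : {B : Set (Set X) // TopologicalSpace.IsTopologicalBasis B} =>
        Cardinal.mk B.1) ⟨∅, h0⟩
    rw [hw, Cardinal.mk_emptyCollection] at h1
    exact absurd (Cardinal.aleph0_pos.trans_le (hk.trans h1)) (lt_irrefl _)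
  have hE : (∃ ι : X → ℕ → StarT k, IsEmbedding ι ∧ DenseRange ι) ∧ Cardinal.mk (StarT k) ≤ k := by
    by_cases h : k = Cardinal.aleph0
    · have h1 : StarT k = ULift Bool := if_pos h
      refine ⟨embed_countable ((Equiv.cast h1).trans Equiv.ulift) hind (h ▸ hnw) (h ▸ hw), ?_⟩
      rw [h1]
      exact Cardinal.mk_le_aleph0.trans hk
    · have h1 : StarT k = DiscT k := if_neg h
      have h2 : Cardinal.mk (StarT k) = k := by rw [h1, mk_DiscT]
      exact ⟨embed_uncountable (lt_of_le_of_ne hk (Ne.symm h)) h2 hind hnw hw, h2.le⟩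
  obtain ⟨⟨ι, hι, hd⟩, hS⟩ := hE
  obtain ⟨hdense, ⟨e⟩⟩ := final_of_embedding hk hS habs hnw hcomp hι hd
  refine ⟨((range ι)ᶜ : Set (ℕ → StarT k)), hdense, ⟨e⟩, ?_⟩
  have h3 : Nonempty (X ≃ₜ ↥(((range ι)ᶜᶜ : Set (ℕ → StarT k)))) := by
    rw [compl_compl]
    exact ⟨hι.toHomeomorph⟩
  exact h3

end Split
end AIIproof

/-- Theorem `t-aR`: a topological characterization of `A^{II}_k`. -/
theorem stmt_11 (k : Cardinal.{u}) (hk : Cardinal.aleph0 ≤ k)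
    (X : Type u) [TopologicalSpace X]
    (habs : AbsGdeltaSigma X) (hind : StronglyZeroDim X)
    (hnw : NowhereFsdMinusSLW X k)
    (hcomp : ∃ D : Set X, Dense D ∧ CompletelyMetrizable ↥D)
    (hw : topWeight X = k) :
    IsAII k X := by
  exact AIIproof.main hk habs hind hnw hcomp hw
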